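/- arXiv:1004.4133 — 11 statements merged into one kernel-verified Lean document; each statement's English description precedes it below -/
import Mathlib

section
/- Let ℓ ≥ 10 be an integer with 3 ∤ ℓ and let q = e^{iπ/ℓ}. Then the quantum integer [7]_q = q^6 + q^4 + q^2 + 1 + q^{-2} + q^{-4} + q^{-6} is not a (rational) integer. -/
/-- The quantum integer `[n]_q = (q^n - q^{-n})/(q - q^{-1})`. -/
noncomputable def qint (q : ℂ) (n : ℕ) : ℂ :=
  (q ^ (n : ℤ) - q ^ (-(n : ℤ))) / (q - q⁻¹)

open Polynomial in
/-- If the quantum integer `[7]` at a primitive `n`-th root of unity `ζ = q ^ 2` is an integer `k`,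
then `k` is also its value at every Galois conjugate `ζ ^ m`. -/
theorem IsPrimitiveRoot.conj_root_seven {ζ : ℂ} {n m : ℕ} (hn : 0 < n) (hζ : IsPrimitiveRoot ζ n)
    (hm : Nat.Coprime m n) {k : ℤ}
    (h : ζ ^ 6 + ζ ^ 5 + ζ ^ 4 + ζ ^ 3 + ζ ^ 2 + ζ + 1 = k * ζ ^ 3) :
    (ζ ^ m) ^ 6 + (ζ ^ m) ^ 5 + (ζ ^ m) ^ 4 + (ζ ^ m) ^ 3 + (ζ ^ m) ^ 2 + ζ ^ m + 1
      = k * (ζ ^ m) ^ 3 := by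
  let P : ℤ[X] := X ^ 6 + X ^ 5 + X ^ 4 + X ^ 3 + X ^ 2 + X + 1 - C k * X ^ 3
  have hP (z : ℂ) : aeval z P = z ^ 6 + z ^ 5 + z ^ 4 + z ^ 3 + z ^ 2 + z + 1 - k * z ^ 3 := by
    simp [P]
  have hdvd : minpoly ℤ ζ ∣ P :=
    minpoly.isIntegrallyClosed_dvd (hζ.isIntegral hn) (by rw [hP, h, sub_self])
  rw [hζ.minpoly_eq_pow_coprime hm] at hdvd
  rw [← sub_eq_zero, ← hP]
  exact aeval_eq_zero_of_dvd_aeval_eq_zero hdvd (minpoly.aeval ℤ _)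

theorem two_mul_cos_cubic_of_root_seven {θ : ℝ} {z : ℂ} {k : ℤ}
    (hz : z = Complex.exp (θ * Complex.I))
    (h : z ^ 6 + z ^ 5 + z ^ 4 + z ^ 3 + z ^ 2 + z + 1 = k * z ^ 3) :
    (2 * Real.cos θ) ^ 3 + (2 * Real.cos θ) ^ 2 - 2 * (2 * Real.cos θ) - 1 = k := by
  have h0 : z ≠ 0 := hz ▸ Complex.exp_ne_zero _
  have hc : 2 * Complex.cos θ = z + z⁻¹ := by
    rw [Complex.two_cos, hz, ← Complex.exp_neg, neg_mul]
  have : ((2 * Complex.cos θ) ^ 3 + (2 * Complex.cos θ) ^ 2 - 2 * (2 * Complex.cos θ) - 1 : ℂ)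
      = k := by
    rw [hc]
    field_simp
    linear_combination h
  exact_mod_cast this

theorem cubic_comp_lt {c : ℝ} (h1 : 8 / 5 ≤ c) (h2 : c < 2) :
    (c ^ 3 - 3 * c) ^ 3 + (c ^ 3 - 3 * c) ^ 2 - 2 * (c ^ 3 - 3 * c) - 1
      < c ^ 3 + c ^ 2 - 2 * c - 1 := by
  have hlt : c ^ 3 - 3 * c < c := by nlinarith [mul_pos (by linarith : 0 < c) (sub_pos.2 h2)]
  have hge : -2 ≤ c ^ 3 - 3 * c := by
    nlinarith [mul_nonneg (by linarith : 0 ≤ c + 2) (sq_nonneg (c - 1))]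
  have hval : 2 < c ^ 3 + c ^ 2 - 2 * c - 1 := by
    nlinarith [mul_nonneg (sub_nonneg.2 h1) (sub_nonneg.2 h1),
      mul_nonneg (sub_nonneg.2 h1) (sq_nonneg c)]
  generalize c ^ 3 - 3 * c = d at *
  rcases le_total d 1 with hd | hd
  · nlinarith [mul_nonneg (by linarith : 0 ≤ d + 2) (sq_nonneg (d + 1)),
      mul_nonneg (by linarith : 0 ≤ 1 - d) (sq_nonneg (d + 1)),
      mul_nonneg (by linarith : 0 ≤ d + 2) (by linarith : 0 ≤ 1 - d)]
  · nlinarith [mul_pos (sub_pos.2 hlt) (by nlinarith : 0 < c ^ 2 + c * d + d ^ 2 + c + d - 2)]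

theorem qint_seven_mul {q : ℂ} (h0 : q ≠ 0) (h1 : q ^ 2 ≠ 1) :
    (q ^ 2) ^ 6 + (q ^ 2) ^ 5 + (q ^ 2) ^ 4 + (q ^ 2) ^ 3 + (q ^ 2) ^ 2 + q ^ 2 + 1
      = qint q 7 * (q ^ 2) ^ 3 := by
  have h2 : q ^ 2 - 1 ≠ 0 := sub_ne_zero.2 h1
  have h3 : q - q⁻¹ = (q ^ 2 - 1) / q := by field_simp
  have h4 : q ^ ((7 : ℕ) : ℤ) - q ^ (-((7 : ℕ) : ℤ)) = (q ^ 14 - 1) / q ^ 7 := by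
    rw [zpow_neg, zpow_natCast]
    field_simp
  rw [qint, h3, h4]
  field_simp
  ring

/-- For `ℓ ≥ 10` with `3 ∤ ℓ` and `q = e^{iπ/ℓ}`, the quantum integer `[7]_q`
is not a rational integer. -/
theorem stmt_0 (ℓ : ℕ) (hℓ : 10 ≤ ℓ) (h3 : ¬ (3 ∣ ℓ))
    (q : ℂ) (hq : q = Complex.exp (Real.pi * Complex.I / (ℓ : ℂ))) :
    ¬ ∃ k : ℤ, qint q 7 = (k : ℂ) := by
  rintro ⟨k, hk⟩
  set θ : ℝ := 2 * Real.pi / ℓ with hθ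
  have hℓR : (10 : ℝ) ≤ ℓ := by exact_mod_cast hℓ
  have hζ : q ^ 2 = Complex.exp (2 * Real.pi * Complex.I / ℓ) := by
    rw [hq, ← Complex.exp_nat_mul]
    push_cast
    ring_nf
  have hprim : IsPrimitiveRoot (q ^ 2) ℓ := hζ ▸ Complex.isPrimitiveRoot_exp ℓ (by omega)
  have hroot := qint_seven_mul (hq ▸ Complex.exp_ne_zero _) (hprim.ne_one (by omega))
  rw [hk] at hroot
  have hconj := hprim.conj_root_seven (by omega)
    ((Nat.Prime.coprime_iff_not_dvd Nat.prime_three).2 h3) hroot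
  have hcos := two_mul_cos_cubic_of_root_seven (θ := θ)
    (by rw [hζ, hθ]; push_cast; ring_nf) hroot
  have hcos3 := two_mul_cos_cubic_of_root_seven (θ := 3 * θ)
    (by rw [hζ, hθ, ← Complex.exp_nat_mul]; push_cast; ring_nf) hconj
  have hθ0 : 0 < θ := by positivity
  have hθ5 : θ ≤ Real.pi / 5 := by
    rw [hθ, div_le_div_iff₀ (by linarith) (by norm_num)]
    nlinarith [Real.pi_pos]
  have hlt : 2 * Real.cos θ < 2 := by
    have := Real.cos_lt_cos_of_nonneg_of_le_pi le_rfl (by linarith [Real.pi_pos]) hθ0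
    rw [Real.cos_zero] at this
    linarith
  have hge : 8 / 5 ≤ 2 * Real.cos θ := by
    have := Real.cos_le_cos_of_nonneg_of_le_pi hθ0.le (by linarith [Real.pi_pos]) hθ5
    rw [Real.cos_pi_div_five] at this
    have : (11 / 5 : ℝ) ≤ √5 := Real.le_sqrt_of_sq_le (by norm_num)
    linarith
  have htriple : 2 * Real.cos (3 * θ) = (2 * Real.cos θ) ^ 3 - 3 * (2 * Real.cos θ) := by
    rw [Real.cos_three_mul]
    ring
  rw [htriple] at hcos3
  linarith [cubic_comp_lt hge hlt]
end

section
/- Let ℓ ≥ 15 be an integer divisible by 3 and let q = e^{iπ/ℓ}. Then [2]_q[7]_q[12]_q/([4]_q[6]_q) is not a (rational) integer. -/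
/-- The polynomial `1 + 2 T₁ + 2 T₄ + 2 T₅` in the Chebyshev polynomials `Tᵢ`. -/
def chebSum {R : Type*} [CommRing R] (c : R) : R :=
  32 * c ^ 5 + 16 * c ^ 4 - 40 * c ^ 3 - 16 * c ^ 2 + 12 * c + 3

lemma chebSum_strictMonoOn : StrictMonoOn (chebSum : ℝ → ℝ) (Set.Ici (9 / 10)) := by
  intro u hu v _ huv
  obtain ⟨s, rfl⟩ : ∃ s, u = 9 / 10 + s := ⟨u - 9 / 10, by ring⟩
  obtain ⟨t, rfl⟩ : ∃ t, v = 9 / 10 + t := ⟨v - 9 / 10, by ring⟩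
  have hs : 0 ≤ s := by simpa using hu
  have hst : s < t := by linarith
  have h2 : s ^ 2 ≤ t ^ 2 := by gcongr
  have h3 : s ^ 3 ≤ t ^ 3 := by gcongr
  have h4 : s ^ 4 ≤ t ^ 4 := by gcongr
  have h5 : s ^ 5 ≤ t ^ 5 := by gcongr
  unfold chebSum
  ring_nf
  linarith

lemma qint_ne_zero {q : ℂ} {ℓ n : ℕ} (hq : IsPrimitiveRoot q (2 * ℓ)) (hn : 0 < n)
    (hnℓ : n < ℓ) : qint q n ≠ 0 := by
  have hq0 : q ≠ 0 := hq.ne_zero (by omega)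
  have sub_ne : ∀ k : ℕ, 0 < k → k < ℓ → q ^ (k : ℤ) - q ^ (-(k : ℤ)) ≠ 0 := by
    intro k hk hkℓ h
    refine hq.pow_ne_one_of_pos_of_lt (l := 2 * k) (by omega) (by omega) ?_
    rw [zpow_neg, zpow_natCast] at h
    calc q ^ (2 * k) = q ^ k * q ^ k := by ring
      _ = (q ^ k)⁻¹ * q ^ k := by rw [← sub_eq_zero.mp h]
      _ = 1 := inv_mul_cancel₀ (pow_ne_zero _ hq0)
  have h1 := sub_ne 1 one_pos (by omega)
  simp only [Nat.cast_one, zpow_one, zpow_neg_one] at h1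
  exact div_ne_zero (sub_ne n hn hnℓ) h1

lemma qint_two_mul {q : ℂ} (hq : q ≠ 0) (n : ℕ) :
    qint q (2 * n) = qint q n * (q ^ n + (q ^ n)⁻¹) := by
  have hn : q ^ n ≠ 0 := pow_ne_zero n hq
  unfold qint
  simp only [zpow_neg, zpow_natCast, div_mul_eq_mul_div]
  congr 1
  rw [mul_comm 2 n, pow_mul]
  field_simp
  ring

lemma qint_seven {q : ℂ} (hq : q ≠ 0) (h1 : q - q⁻¹ ≠ 0) :
    qint q 7 = q ^ 6 + q ^ 4 + q ^ 2 + 1 + (q ^ 2)⁻¹ + (q ^ 4)⁻¹ + (q ^ 6)⁻¹ := by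
  unfold qint
  rw [div_eq_iff h1, zpow_neg, zpow_natCast]
  field_simp
  ring

lemma qint_quotient_eq {q : ℂ} {ℓ : ℕ} (hq : IsPrimitiveRoot q (2 * ℓ)) (hℓ : 15 ≤ ℓ) :
    qint q 2 * qint q 7 * qint q 12 / (qint q 4 * qint q 6) =
      chebSum ((q ^ 2 + (q ^ 2)⁻¹) / 2) := by
  have hq0 : q ≠ 0 := hq.ne_zero (by omega)
  have h4 := qint_ne_zero hq (n := 4) (by omega) (by omega)
  have h6 := qint_ne_zero hq (n := 6) (by omega) (by omega)
  have h1 : q - q⁻¹ ≠ 0 := fun h => h4 (by simp [qint, h])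
  rw [div_eq_iff (mul_ne_zero h4 h6), qint_two_mul hq0 6, qint_two_mul hq0 2,
    qint_seven hq0 h1]
  unfold chebSum
  field_simp
  ring

lemma chebSum_cos_bounds {x a b : ℝ} (ha : 0 ≤ a) (hax : a ≤ x) (hxb : x ≤ b)
    (hb : b ≤ 21 / 50) :
    chebSum (1 - b ^ 2 / 2 - b ^ 4 * (5 / 96)) ≤ chebSum (Real.cos x) ∧
      chebSum (Real.cos x) ≤ chebSum (1 - a ^ 2 / 2 + a ^ 4 * (5 / 96)) := by
  have hb0 : 0 ≤ b := by linarith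
  have hπ := Real.pi_gt_three
  have hcb := abs_le.mp (Real.cos_bound (x := b) (by rw [abs_of_nonneg hb0]; linarith))
  have hca := abs_le.mp (Real.cos_bound (x := a) (by rw [abs_of_nonneg ha]; linarith))
  rw [abs_of_nonneg hb0] at hcb
  rw [abs_of_nonneg ha] at hca
  have hbx : Real.cos b ≤ Real.cos x :=
    Real.cos_le_cos_of_nonneg_of_le_pi (by linarith) (by linarith) hxb
  have hxa : Real.cos x ≤ Real.cos a :=
    Real.cos_le_cos_of_nonneg_of_le_pi ha (by linarith) hax
  have hb2 : b ^ 2 ≤ (21 / 50) ^ 2 := by gcongr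
  have hb4 : b ^ 4 ≤ (21 / 50) ^ 4 := by gcongr
  have hlow : 9 / 10 ≤ 1 - b ^ 2 / 2 - b ^ 4 * (5 / 96) := by linarith
  have hcx : 9 / 10 ≤ Real.cos x := by linarith
  exact ⟨chebSum_strictMonoOn.monotoneOn hlow hcx (by linarith),
    chebSum_strictMonoOn.monotoneOn hcx (hcx.trans (by linarith)) (by linarith)⟩

lemma chebSum_cos_ne_intCast {ℓ : ℕ} (hℓ : 15 ≤ ℓ) (h3 : 3 ∣ ℓ) (k : ℤ) :
    chebSum (Real.cos (2 * Real.pi / ℓ)) ≠ k := by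
  intro hk
  have between : ∀ n : ℤ, (n : ℝ) < chebSum (Real.cos (2 * Real.pi / ℓ)) →
      chebSum (Real.cos (2 * Real.pi / ℓ)) < ((n + 1 : ℤ) : ℝ) → False := by
    intro n hn hn'
    rw [hk, Int.cast_lt] at hn hn'
    omega
  have hπ := Real.pi_gt_d4
  have hπ' := Real.pi_lt_d4
  have hℓ' : (15 : ℝ) ≤ ℓ := by exact_mod_cast hℓ
  have hpos : 0 < 2 * Real.pi / ℓ := by positivity
  obtain hlt | hge := lt_or_ge ℓ 42
  · obtain ⟨hl, hu⟩ := chebSum_cos_bounds (x := 2 * Real.pi / ℓ) (a := 6.283 / ℓ)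
      (b := 6.2832 / ℓ) (by positivity) (by gcongr; linarith) (by gcongr; linarith)
      (by rw [div_le_iff₀ (by linarith)]; linarith)
    obtain ⟨m, rfl⟩ := h3
    have hm5 : 5 ≤ m := by omega
    have hm14 : m < 14 := by omega
    clear hk hℓ hℓ' hlt hpos
    interval_cases m
    · exact between 1 (hl.trans_lt' (by norm_num [chebSum])) (hu.trans_lt (by norm_num [chebSum]))
    · exact between 2 (hl.trans_lt' (by norm_num [chebSum])) (hu.trans_lt (by norm_num [chebSum]))
    · exact between 3 (hl.trans_lt' (by norm_num [chebSum])) (hu.trans_lt (by norm_num [chebSum]))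
    · exact between 4 (hl.trans_lt' (by norm_num [chebSum])) (hu.trans_lt (by norm_num [chebSum]))
    · exact between 4 (hl.trans_lt' (by norm_num [chebSum])) (hu.trans_lt (by norm_num [chebSum]))
    all_goals
      exact between 5 (hl.trans_lt' (by norm_num [chebSum])) (hu.trans_lt (by norm_num [chebSum]))
  · have hge' : (42 : ℝ) ≤ ℓ := by exact_mod_cast hge
    have hle : 2 * Real.pi / ℓ ≤ 0.1496 := by
      rw [div_le_iff₀ (by linarith)]
      linarith
    have hl := (chebSum_cos_bounds le_rfl hpos.le hle (by norm_num)).1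
    have hcos : Real.cos (2 * Real.pi / ℓ) < 1 := by
      simpa using Real.cos_lt_cos_of_nonneg_of_le_pi le_rfl (by linarith) hpos
    have hcos' : 9 / 10 ≤ Real.cos (2 * Real.pi / ℓ) := by
      have hsq : (2 * Real.pi / ℓ) ^ 2 ≤ 0.1496 ^ 2 := by gcongr
      linarith [Real.one_sub_sq_div_two_le_cos (x := 2 * Real.pi / ℓ)]
    have hu := chebSum_strictMonoOn hcos' (by norm_num : (1 : ℝ) ∈ Set.Ici (9 / 10)) hcos
    exact between 6 (hl.trans_lt' (by norm_num [chebSum])) (hu.trans_eq (by norm_num [chebSum]))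

/-- For `ℓ ≥ 15` divisible by `3` and `q = e^{iπ/ℓ}`, the quantity
`[2]_q[7]_q[12]_q/([4]_q[6]_q)` is not a rational integer. -/
theorem stmt_2 (ℓ : ℕ) (hℓ : 15 ≤ ℓ) (h3 : 3 ∣ ℓ)
    (q : ℂ) (hq : q = Complex.exp (Real.pi * Complex.I / (ℓ : ℂ))) :
    ¬ ∃ k : ℤ, qint q 2 * qint q 7 * qint q 12 / (qint q 4 * qint q 6) = (k : ℂ) := by
  rintro ⟨k, hk⟩
  have hprim : IsPrimitiveRoot q (2 * ℓ) := by
    convert Complex.isPrimitiveRoot_exp (2 * ℓ) (by omega) using 1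
    rw [hq]
    congr 1
    push_cast
    field_simp
  have hcos : (q ^ 2 + (q ^ 2)⁻¹) / 2 = ((Real.cos (2 * Real.pi / ℓ) : ℝ) : ℂ) := by
    rw [hq, ← Complex.exp_nat_mul, ← Complex.exp_neg, Complex.ofReal_cos, Complex.cos]
    push_cast
    ring_nf
  rw [qint_quotient_eq hprim hℓ, hcos] at hk
  refine chebSum_cos_ne_intCast hℓ h3 k ?_
  unfold chebSum at hk ⊢
  exact_mod_cast hk
end

section
/- Let ℓ ≥ 15 be an integer and q = e^{iπ/ℓ}. Then [2]_q[7]_q[12]_q/([4]_q[6]_q) = q^{10} + q^8 + q^2 + 1 + q^{−2} + q^{−8} + q^{−10}. Consequently, if [2]_q[7]_q[12]_q/([4]_q[6]_q) = k for some integer k, then q^{20} + q^{18} + q^{12} + (1 − k)q^{10} + q^8 + q^2 + 1 = 0, and hence φ(2ℓ) ≤ 20. -/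
open Polynomial in
/-- A primitive `n`-th root of unity over `ℚ` is not a root of a nonzero polynomial of degree
below `φ(n)`. -/
lemma IsPrimitiveRoot.totient_le_natDegree_of_aeval_eq_zero {K : Type*} [Field K] [CharZero K]
    {n : ℕ} {μ : K} (hμ : IsPrimitiveRoot μ n) (hn : 0 < n) {p : ℚ[X]} (hp : p ≠ 0)
    (h : aeval μ p = 0) : n.totient ≤ p.natDegree := by
  rw [← natDegree_cyclotomic n ℚ, cyclotomic_eq_minpoly_rat hμ hn]
  exact natDegree_le_of_dvd (minpoly.dvd ℚ μ h) hp

open Polynomial in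
lemma IsPrimitiveRoot.totient_le_twenty_of_root {q : ℂ} {n : ℕ} (hq : IsPrimitiveRoot q n)
    (hn : 0 < n) {k : ℤ}
    (hroot : q ^ 20 + q ^ 18 + q ^ 12 + (1 - (k : ℂ)) * q ^ 10 + q ^ 8 + q ^ 2 + 1 = 0) :
    n.totient ≤ 20 := by
  have hdeg : (X ^ 20 + X ^ 18 + X ^ 12 + C (1 - (k : ℚ)) * X ^ 10 + X ^ 8 + X ^ 2 + 1 :
      ℚ[X]).natDegree = 20 := by compute_degree!
  rw [← hdeg]
  refine hq.totient_le_natDegree_of_aeval_eq_zero hn (fun h => ?_) ?_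
  · rw [h] at hdeg
    simp at hdeg
  · simpa using hroot

/-- `[n]_q` with its denominators cleared. -/
lemma qint_eq_div {q : ℂ} (hq : q ≠ 0) (n : ℕ) :
    qint q n = q * (q ^ (2 * n) - 1) / (q ^ n * (q ^ 2 - 1)) := by
  have h1 : q ^ (n : ℤ) - q ^ (-(n : ℤ)) = (q ^ (2 * n) - 1) / q ^ n := by
    rw [zpow_neg, zpow_natCast]
    field_simp
    ring
  have h2 : q - q⁻¹ = (q ^ 2 - 1) / q := by field_simp
  rw [qint, h1, h2, div_div_div_eq, mul_comm q]

/-- `[2][7][12] / ([4][6])` as a Laurent polynomial in `q`. -/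
lemma qint_two_mul_seven_mul_twelve_div {q : ℂ} (hq : q ≠ 0) (h2 : q ^ 2 ≠ 1) (h8 : q ^ 8 ≠ 1)
    (h12 : q ^ 12 ≠ 1) :
    qint q 2 * qint q 7 * qint q 12 / (qint q 4 * qint q 6) =
      q ^ (10 : ℤ) + q ^ (8 : ℤ) + q ^ (2 : ℤ) + 1 + q ^ (-2 : ℤ) +
        q ^ (-8 : ℤ) + q ^ (-10 : ℤ) := by
  have h2' := sub_ne_zero.mpr h2
  have h8' := sub_ne_zero.mpr h8
  have h12' := sub_ne_zero.mpr h12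
  have hr : q ^ (10 : ℤ) + q ^ (8 : ℤ) + q ^ (2 : ℤ) + 1 + q ^ (-2 : ℤ) +
      q ^ (-8 : ℤ) + q ^ (-10 : ℤ) =
      (q ^ 20 + q ^ 18 + q ^ 12 + q ^ 10 + q ^ 8 + q ^ 2 + 1) / q ^ 10 := by
    simp only [zpow_neg, zpow_ofNat]
    field_simp
  have hl : qint q 2 * qint q 7 * qint q 12 / (qint q 4 * qint q 6) =
      (q ^ 4 - 1) * (q ^ 14 - 1) * (q ^ 24 - 1) /
        (q ^ 10 * ((q ^ 2 - 1) * (q ^ 8 - 1) * (q ^ 12 - 1))) := by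
    simp only [qint_eq_div hq, Nat.reduceMul]
    generalize q ^ 2 - 1 = a at *
    generalize q ^ 8 - 1 = b at *
    generalize q ^ 12 - 1 = c at *
    field_simp
  rw [hl, hr, div_eq_div_iff (by positivity) (by positivity)]
  ring

/-- For `ℓ ≥ 15` and `q = e^{iπ/ℓ}`:
`[2]_q[7]_q[12]_q/([4]_q[6]_q) = q^{10}+q^8+q^2+1+q^{-2}+q^{-8}+q^{-10}`; and
if this quantity equals an integer `k` then
`q^{20}+q^{18}+q^{12}+(1-k)q^{10}+q^8+q^2+1 = 0` and `φ(2ℓ) ≤ 20`. -/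
theorem stmt_3 (ℓ : ℕ) (hℓ : 15 ≤ ℓ)
    (q : ℂ) (hq : q = Complex.exp (Real.pi * Complex.I / (ℓ : ℂ))) :
    qint q 2 * qint q 7 * qint q 12 / (qint q 4 * qint q 6) =
      q ^ (10 : ℤ) + q ^ (8 : ℤ) + q ^ (2 : ℤ) + 1 + q ^ (-2 : ℤ) +
        q ^ (-8 : ℤ) + q ^ (-10 : ℤ) ∧
    ∀ k : ℤ, qint q 2 * qint q 7 * qint q 12 / (qint q 4 * qint q 6) = (k : ℂ) →
      q ^ 20 + q ^ 18 + q ^ 12 + (1 - (k : ℂ)) * q ^ 10 + q ^ 8 + q ^ 2 + 1 = 0 ∧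
        Nat.totient (2 * ℓ) ≤ 20 := by
  have hprim : IsPrimitiveRoot q (2 * ℓ) := by
    convert! Complex.isPrimitiveRoot_exp (2 * ℓ) (by omega) using 1
    rw [hq]
    congr 1
    push_cast
    field_simp
  have hq0 : q ≠ 0 := hq ▸ Complex.exp_ne_zero _
  have hid := qint_two_mul_seven_mul_twelve_div hq0
    (hprim.pow_ne_one_of_pos_of_lt (by omega) (by omega))
    (hprim.pow_ne_one_of_pos_of_lt (by omega) (by omega))
    (hprim.pow_ne_one_of_pos_of_lt (by omega) (by omega))
  refine ⟨hid, fun k hk => ?_⟩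
  have hroot : q ^ 20 + q ^ 18 + q ^ 12 + (1 - (k : ℂ)) * q ^ 10 + q ^ 8 + q ^ 2 + 1 = 0 := by
    rw [← hk, hid]
    simp only [zpow_neg, zpow_ofNat]
    field_simp
    ring
  refine ⟨hroot, ?_⟩
  exact hprim.totient_le_twenty_of_root (by omega) hroot
end

section
/- Let ℓ ≥ 14 be an integer and q = e^{iπ/ℓ}. Then [8]_q[9]_q[13]_q/([4]_q[3]_q) is not a (rational) integer. -/
open Polynomial in
/-- Primitive roots of unity of the same order are roots of the same integer polynomials. -/
theorem aeval_pow_eq_zero_of_coprime {ζ : ℂ} {n a : ℕ} (hn : 0 < n) (hζ : IsPrimitiveRoot ζ n)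
    (ha : a.Coprime n) {p : ℤ[X]} (hp : aeval ζ p = 0) : aeval (ζ ^ a) p = 0 := by
  have hdvd : minpoly ℤ ζ ∣ p := minpoly.isIntegrallyClosed_dvd (hζ.isIntegral hn) hp
  rw [hζ.minpoly_eq_pow_coprime ha] at hdvd
  exact aeval_eq_zero_of_dvd_aeval_eq_zero hdvd (minpoly.aeval ℤ (ζ ^ a))

/-- Some integer coprime to `n` is within `2` of `n / 2`. -/
theorem exists_coprime_near_half {n : ℕ} (hn : 4 ≤ n) :
    ∃ a : ℕ, a.Coprime n ∧ n ≤ 2 * a + 4 ∧ 2 * a ≤ n := by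
  have key : (∃ m, n = 2 * m + 1) ∨ (∃ m, n = 4 * m + 4) ∨ ∃ m, n = 4 * m + 6 := by
    rcases (by omega : n % 2 = 1 ∨ n % 4 = 0 ∨ n % 4 = 2) with h | h | h
    · exact .inl ⟨n / 2, by omega⟩
    · exact .inr (.inl ⟨n / 4 - 1, by omega⟩)
    · exact .inr (.inr ⟨n / 4 - 1, by omega⟩)
  rcases key with ⟨m, rfl⟩ | ⟨m, rfl⟩ | ⟨m, rfl⟩
  · refine ⟨m, Nat.isCoprime_iff_coprime.1 ⟨-2, 1, ?_⟩, by omega, by omega⟩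
    push_cast; ring
  · refine ⟨2 * m + 1, Nat.isCoprime_iff_coprime.1 ⟨-1 - 2 * (m + 1), m + 1, ?_⟩,
      by omega, by omega⟩
    push_cast; ring
  · refine ⟨2 * m + 1, Nat.isCoprime_iff_coprime.1
      ⟨2 * m + 1 + 2 * (m ^ 2 + m), -(m ^ 2 + m), ?_⟩, by omega, by omega⟩
    push_cast; ring

/-- The value of `[8][9][13]/([4][3])` at `q = e^{it/2}`, as a trigonometric expression. -/
noncomputable def trigDim (t : ℝ) : ℝ :=
  2 * Real.cos (2 * t) * (1 + 2 * Real.cos (3 * t)) *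
    (1 + 2 * (Real.cos t + Real.cos (2 * t) + Real.cos (3 * t) + Real.cos (4 * t) +
      Real.cos (5 * t) + Real.cos (6 * t)))

theorem pow_mul_trigDim (t : ℝ) {ζ : ℂ} (hζ : ζ = Complex.exp (t * Complex.I)) :
    ζ ^ 11 * (trigDim t : ℂ) =
      (ζ ^ 4 + 1) * (ζ ^ 6 + ζ ^ 3 + 1) * ∑ i ∈ Finset.range 13, ζ ^ i := by
  have h0 : ζ ≠ 0 := hζ ▸ Complex.exp_ne_zero _
  have hcos (n : ℕ) : Complex.cos (n * t) = (ζ ^ n + (ζ ^ n)⁻¹) / 2 := by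
    rw [Complex.cos, hζ, ← Complex.exp_nat_mul, ← Complex.exp_neg]
    ring_nf
  have h1 := hcos 1
  have h2 := hcos 2
  have h3 := hcos 3
  have h4 := hcos 4
  have h5 := hcos 5
  have h6 := hcos 6
  push_cast at h1 h2 h3 h4 h5 h6
  rw [one_mul] at h1
  simp only [trigDim, Finset.sum_range_succ, Finset.sum_range_zero]
  push_cast
  rw [h1, h2, h3, h4, h5, h6]
  field_simp
  ring

theorem pow_mul_qint_quotient {q : ℂ} (h0 : q ≠ 0) (h6 : q ^ 6 ≠ 1) (h8 : q ^ 8 ≠ 1) :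
    (q ^ 2) ^ 11 * (qint q 8 * qint q 9 * qint q 13 / (qint q 4 * qint q 3)) =
      ((q ^ 2) ^ 4 + 1) * ((q ^ 2) ^ 6 + (q ^ 2) ^ 3 + 1) *
        ∑ i ∈ Finset.range 13, (q ^ 2) ^ i := by
  have h2 : q ^ 2 - 1 ≠ 0 := fun h => h6 (by
    rw [show q ^ 6 = (q ^ 2) ^ 3 by ring, sub_eq_zero.1 h, one_pow])
  have hq (n : ℕ) : qint q n = q * ((q ^ n) ^ 2 - 1) / (q ^ n * (q ^ 2 - 1)) := by
    have : q - q⁻¹ = (q ^ 2 - 1) / q := by field_simp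
    rw [qint, zpow_neg, zpow_natCast, this]
    field_simp
  have h6' : (q ^ 3) ^ 2 - 1 ≠ 0 := by rw [← pow_mul]; exact sub_ne_zero.2 h6
  have h8' : (q ^ 4) ^ 2 - 1 ≠ 0 := by rw [← pow_mul]; exact sub_ne_zero.2 h8
  have hgeom := geom_sum_mul (q ^ 2) 13
  rw [← eq_div_iff h2] at hgeom
  rw [hgeom]
  simp only [hq]
  generalize ha : (q ^ 3) ^ 2 - 1 = a at *
  generalize hb : (q ^ 4) ^ 2 - 1 = b at *
  have h9 : (q ^ 9) ^ 2 - 1 = a * (q ^ 12 + q ^ 6 + 1) := by rw [← ha]; ring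
  have h8'' : (q ^ 8) ^ 2 - 1 = b * (q ^ 8 + 1) := by rw [← hb]; ring
  rw [h9, h8'']
  generalize q ^ 2 - 1 = c at *
  field_simp

theorem trigDim_lower {t : ℝ} (h0 : 0 ≤ t) (ht : t ≤ Real.pi / 8) : 7 < trigDim t := by
  have hpi := Real.pi_pos
  have mono (n : ℝ) (hn : 0 ≤ n) (hn8 : n ≤ 8) :
      Real.cos (n * (Real.pi / 8)) ≤ Real.cos (n * t) :=
    Real.cos_le_cos_of_nonneg_of_le_pi (by positivity) (by nlinarith)
      (mul_le_mul_of_nonneg_left ht hn)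
  have m1 := mono 1 (by norm_num) (by norm_num)
  have m2 := mono 2 (by norm_num) (by norm_num)
  have m3 := mono 3 (by norm_num) (by norm_num)
  have m4 := mono 4 (by norm_num) (by norm_num)
  have m5 := mono 5 (by norm_num) (by norm_num)
  have m6 := mono 6 (by norm_num) (by norm_num)
  rw [one_mul, one_mul] at m1
  rw [show 2 * (Real.pi / 8) = Real.pi / 4 by ring, Real.cos_pi_div_four] at m2
  rw [show 3 * (Real.pi / 8) = Real.pi / 2 - Real.pi / 8 by ring, Real.cos_pi_div_two_sub] at m3
  rw [show 4 * (Real.pi / 8) = Real.pi / 2 by ring, Real.cos_pi_div_two] at m4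
  rw [show 5 * (Real.pi / 8) = Real.pi / 8 + Real.pi / 2 by ring, Real.cos_add_pi_div_two] at m5
  rw [show 6 * (Real.pi / 8) = Real.pi - Real.pi / 4 by ring, Real.cos_pi_sub,
    Real.cos_pi_div_four] at m6
  have hsqrt : (1.414 : ℝ) < √2 := Real.lt_sqrt_of_sq_lt (by norm_num)
  have hsqrt' : √2 < (1.415 : ℝ) := (Real.sqrt_lt' (by norm_num)).2 (by norm_num)
  have hc : (0.923 : ℝ) < Real.cos (Real.pi / 8) := by
    rw [Real.cos_pi_div_eight]
    have : (1.846 : ℝ) < √(2 + √2) := Real.lt_sqrt_of_sq_lt (by norm_num; linarith)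
    linarith
  have hs : (0.382 : ℝ) < Real.sin (Real.pi / 8) := by
    rw [Real.sin_pi_div_eight]
    have : (0.764 : ℝ) < √(2 - √2) := Real.lt_sqrt_of_sq_lt (by norm_num; linarith)
    linarith
  have f1 : (1.414 : ℝ) ≤ 2 * Real.cos (2 * t) := by linarith
  have f2 : (1.764 : ℝ) ≤ 1 + 2 * Real.cos (3 * t) := by linarith
  have f3 : (2.846 : ℝ) ≤ 1 + 2 * (Real.cos t + Real.cos (2 * t) + Real.cos (3 * t) +
      Real.cos (4 * t) + Real.cos (5 * t) + Real.cos (6 * t)) := by linarith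
  calc (7 : ℝ) < 1.414 * 1.764 * 2.846 := by norm_num
    _ ≤ trigDim t := by unfold trigDim; gcongr

theorem trigDim_fourteen : trigDim (2 * Real.pi / 14) = 2 * Real.cos (Real.pi / 7) := by
  rw [show 2 * Real.pi / 14 = Real.pi / 7 by ring, trigDim]
  rw [show 4 * (Real.pi / 7) = Real.pi - 3 * (Real.pi / 7) by ring,
    show 5 * (Real.pi / 7) = Real.pi - 2 * (Real.pi / 7) by ring,
    show 6 * (Real.pi / 7) = Real.pi - Real.pi / 7 by ring]
  simp only [Real.cos_pi_sub]
  have h := Real.cos_add_cos (5 * (Real.pi / 7)) (Real.pi / 7)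
  rw [show 5 * (Real.pi / 7) = Real.pi - 2 * (Real.pi / 7) by ring, Real.cos_pi_sub,
    show (Real.pi - 2 * (Real.pi / 7) + Real.pi / 7) / 2 = 3 * (Real.pi / 7) by ring,
    show (Real.pi - 2 * (Real.pi / 7) - Real.pi / 7) / 2 = 2 * (Real.pi / 7) by ring] at h
  linear_combination -2 * h

theorem trigDim_fifteen : trigDim (2 * Real.pi / 15) = 2 + √5 := by
  have hc5 := Real.cos_pi_div_five
  have c3 : Real.cos (3 * (2 * Real.pi / 15)) = (√5 - 1) / 4 := by
    rw [show 3 * (2 * Real.pi / 15) = 2 * (Real.pi / 5) by ring, Real.cos_two_mul, hc5]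
    nlinarith [Real.sq_sqrt (show (0 : ℝ) ≤ 5 by norm_num)]
  have c6 : Real.cos (6 * (2 * Real.pi / 15)) = -((1 + √5) / 4) := by
    rw [show 6 * (2 * Real.pi / 15) = Real.pi - Real.pi / 5 by ring, Real.cos_pi_sub, hc5]
  have c5 : Real.cos (5 * (2 * Real.pi / 15)) = -(1 / 2) := by
    rw [show 5 * (2 * Real.pi / 15) = Real.pi - Real.pi / 3 by ring, Real.cos_pi_sub,
      Real.cos_pi_div_three]
  have c1 : Real.cos (2 * Real.pi / 15) + Real.cos (4 * (2 * Real.pi / 15)) =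
      Real.cos (Real.pi / 5) := by
    rw [Real.cos_add_cos, show (2 * Real.pi / 15 + 4 * (2 * Real.pi / 15)) / 2 = Real.pi / 3 by
      ring, show (2 * Real.pi / 15 - 4 * (2 * Real.pi / 15)) / 2 = -(Real.pi / 5) by ring,
      Real.cos_neg, Real.cos_pi_div_three]
    ring
  have c4 : Real.cos (4 * (2 * Real.pi / 15)) =
      2 * Real.cos (2 * (2 * Real.pi / 15)) ^ 2 - 1 := by
    rw [← Real.cos_two_mul]
    congr 1
    ring
  have c23 := Real.cos_add_cos (5 * (2 * Real.pi / 15)) (2 * Real.pi / 15)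
  rw [show (5 * (2 * Real.pi / 15) + 2 * Real.pi / 15) / 2 = 3 * (2 * Real.pi / 15) by ring,
    show (5 * (2 * Real.pi / 15) - 2 * Real.pi / 15) / 2 = 2 * (2 * Real.pi / 15) by ring,
    c3, c5] at c23
  rw [trigDim, c3, c5, c6]
  rw [hc5] at c1
  have h5 := Real.sq_sqrt (show (0 : ℝ) ≤ 5 by norm_num)
  generalize Real.cos (2 * Real.pi / 15) = x1 at *
  generalize Real.cos (2 * (2 * Real.pi / 15)) = x2 at *
  generalize Real.cos (4 * (2 * Real.pi / 15)) = x4 at *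
  have hx4 : x4 = (1 + √5) / 4 - x1 := by linarith
  subst hx4
  have hx : 4 * x2 ^ 2 + x2 * (√5 - 1) = (3 + √5) / 2 := by linarith
  linear_combination (1 + √5) / 2 * hx + h5 / 4

/-- A conjugate near `-1` bounds an integer value of the quotient. -/
theorem intCast_lt_seven_of_cos_le {w : ℂ} {k : ℤ} {s : ℝ} (hw : w = Complex.exp (s * Complex.I))
    (hs : Real.cos s ≤ -(7 / 10))
    (h : (w ^ 4 + 1) * (w ^ 6 + w ^ 3 + 1) * ∑ i ∈ Finset.range 13, w ^ i = k * w ^ 11) :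
    (k : ℝ) < 7 := by
  have hn : ‖w‖ = 1 := by rw [hw, Complex.norm_exp_ofReal_mul_I]
  have hdist : (1.8 : ℝ) ≤ ‖w - 1‖ := by
    rw [hw, Complex.norm_def]
    refine Real.le_sqrt_of_sq_le ?_
    rw [Complex.normSq_apply]
    simp only [Complex.sub_re, Complex.sub_im, Complex.exp_ofReal_mul_I_re,
      Complex.exp_ofReal_mul_I_im, Complex.one_re, Complex.one_im]
    nlinarith [Real.sin_sq_add_cos_sq s]
  have hpow (n : ℕ) : ‖w ^ n‖ = 1 := by rw [norm_pow, hn, one_pow]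
  have h4 : ‖w ^ 4 + 1‖ ≤ 2 := (norm_add_le _ _).trans (by rw [hpow, norm_one]; norm_num)
  have h6 : ‖w ^ 6 + w ^ 3 + 1‖ ≤ 3 := (norm_add₃_le).trans (by
    rw [hpow, hpow, norm_one]; norm_num)
  have h13 : ‖w ^ 13 - 1‖ ≤ 2 := (norm_sub_le _ _).trans (by rw [hpow, norm_one]; norm_num)
  have key : (k : ℂ) * w ^ 11 * (w - 1) = (w ^ 4 + 1) * (w ^ 6 + w ^ 3 + 1) * (w ^ 13 - 1) := by
    rw [← h, mul_assoc, geom_sum_mul]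
  have hnorm := congrArg norm key
  rw [norm_mul, norm_mul, norm_mul, norm_mul, hpow, mul_one, Complex.norm_intCast] at hnorm
  have hle : |(k : ℝ)| * ‖w - 1‖ ≤ 2 * 3 * 2 := by rw [hnorm]; gcongr
  nlinarith [le_abs_self (k : ℝ), abs_nonneg (k : ℝ)]

/-- For `ℓ ≥ 14` and `q = e^{iπ/ℓ}`, the quantity `[8]_q[9]_q[13]_q/([4]_q[3]_q)`
is not a rational integer. -/
theorem stmt_4 (ℓ : ℕ) (hℓ : 14 ≤ ℓ)
    (q : ℂ) (hq : q = Complex.exp (Real.pi * Complex.I / (ℓ : ℂ))) :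
    ¬ ∃ k : ℤ, qint q 8 * qint q 9 * qint q 13 / (qint q 4 * qint q 3) = (k : ℂ) := by
  rintro ⟨k, hk⟩
  have hℓ0 : (ℓ : ℂ) ≠ 0 := by exact_mod_cast (by omega : ℓ ≠ 0)
  have hℓ0' : (0 : ℝ) < ℓ := by exact_mod_cast (by omega : 0 < ℓ)
  have hpi := Real.pi_pos
  have hqprim : IsPrimitiveRoot q (2 * ℓ) := by
    convert Complex.isPrimitiveRoot_exp (2 * ℓ) (by omega) using 1
    rw [hq]
    congr 1
    push_cast
    field_simp
  have hζprim : IsPrimitiveRoot (q ^ 2) ℓ := hqprim.pow (by omega) rfl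
  have hζ : q ^ 2 = Complex.exp ((2 * Real.pi / ℓ : ℝ) * Complex.I) := by
    rw [hq, ← Complex.exp_nat_mul]
    congr 1
    push_cast
    ring
  have h0 : q ≠ 0 := hq ▸ Complex.exp_ne_zero _
  have hD := pow_mul_qint_quotient h0 (hqprim.pow_ne_one_of_pos_of_lt (by omega) (by omega))
    (hqprim.pow_ne_one_of_pos_of_lt (by omega) (by omega))
  have hkt : trigDim (2 * Real.pi / ℓ) = k := by
    have := (pow_mul_trigDim _ hζ).trans hD.symm
    rw [hk] at this
    exact_mod_cast mul_left_cancel₀ (pow_ne_zero 11 (pow_ne_zero 2 h0)) this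
  rcases (by omega : ℓ = 14 ∨ ℓ = 15 ∨ 16 ≤ ℓ) with rfl | rfl | h16
  · push_cast at hkt
    rw [trigDim_fourteen] at hkt
    have hlt : Real.cos (Real.pi / 7) < 1 := by
      rw [← Real.cos_zero]
      exact Real.cos_lt_cos_of_nonneg_of_le_pi le_rfl (by linarith) (by positivity)
    have hgt : 1 / 2 < Real.cos (Real.pi / 7) := by
      rw [← Real.cos_pi_div_three]
      exact Real.cos_lt_cos_of_nonneg_of_le_pi (by positivity) (by linarith) (by linarith)
    have h1 : (1 : ℝ) < k := by linarith
    have h2 : (k : ℝ) < 2 := by linarith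
    norm_cast at h1 h2
    omega
  · push_cast at hkt
    rw [trigDim_fifteen] at hkt
    have hlt : √5 < 3 := (Real.sqrt_lt' (by norm_num)).2 (by norm_num)
    have hgt : 2 < √5 := Real.lt_sqrt_of_sq_lt (by norm_num)
    have h1 : (4 : ℝ) < k := by linarith
    have h2 : (k : ℝ) < 5 := by linarith
    norm_cast at h1 h2
    omega
  · have h16' : (16 : ℝ) ≤ ℓ := by exact_mod_cast h16
    have hlower := trigDim_lower (t := 2 * Real.pi / ℓ) (by positivity) (by
      rw [div_le_div_iff₀ hℓ0' (by norm_num)]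
      nlinarith)
    obtain ⟨a, hacop, ha, ha'⟩ := exists_coprime_near_half (n := ℓ) (by omega)
    have haℓ : (ℓ : ℝ) ≤ 2 * a + 4 := by exact_mod_cast ha
    have haℓ' : 2 * (a : ℝ) ≤ ℓ := by exact_mod_cast ha'
    have hroot := aeval_pow_eq_zero_of_coprime (by omega) hζprim hacop
      (p := (.X ^ 4 + 1) * (.X ^ 6 + .X ^ 3 + 1) * (∑ i ∈ Finset.range 13, .X ^ i) -
        .C k * .X ^ 11) (by
        simp only [map_sub, map_mul, map_add, map_sum, map_pow, map_one,
          Polynomial.aeval_X, Polynomial.aeval_C]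
        rw [← hD, hk]
        simp [mul_comm])
    simp only [map_sub, map_mul, map_add, map_sum, map_pow, map_one,
      Polynomial.aeval_X, map_intCast, sub_eq_zero, eq_intCast] at hroot
    have hw : (q ^ 2) ^ a = Complex.exp ((2 * Real.pi * a / ℓ : ℝ) * Complex.I) := by
      rw [hζ, ← Complex.exp_nat_mul]
      congr 1
      push_cast
      ring
    have hcos : Real.cos (2 * Real.pi * a / ℓ) ≤ -(7 / 10) := by
      have hle : Real.cos (2 * Real.pi * a / ℓ) ≤ Real.cos (Real.pi - Real.pi / 4) := by
        refine Real.cos_le_cos_of_nonneg_of_le_pi (by linarith) ?_ ?_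
        · rw [div_le_iff₀ hℓ0']
          nlinarith
        · rw [le_div_iff₀ hℓ0']
          nlinarith
      rw [Real.cos_pi_sub, Real.cos_pi_div_four] at hle
      have : (1.4 : ℝ) < √2 := Real.lt_sqrt_of_sq_lt (by norm_num)
      linarith
    have hupper := intCast_lt_seven_of_cos_le hw hcos hroot
    linarith
end

section
/- Let ℓ ≥ 20 be an integer and q = e^{iπ/ℓ}. Then [12]_q[14]_q[19]_q/([4]_q[6]_q) is not a (rational) integer. -/
open Polynomial in
/-- The relation `sin 12t · sin 14t · sin 19t = k · sin 4t · sin 6t · sin t`, as a polynomial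
relation in `exp (2it)`. -/
noncomputable def sinRelPoly (k : ℤ) : ℤ[X] :=
  (X ^ 12 - 1) * (X ^ 14 - 1) * (X ^ 19 - 1) - C k * X ^ 17 * ((X ^ 4 - 1) * (X ^ 6 - 1) * (X - 1))

/-- `[12]_q [14]_q [19]_q = k [4]_q [6]_q` at `q = exp (it)`, with denominators cleared. -/
def SinRel (k : ℤ) (t : ℝ) : Prop :=
  Real.sin (12 * t) * Real.sin (14 * t) * Real.sin (19 * t) =
    k * (Real.sin (4 * t) * Real.sin (6 * t) * Real.sin t)

lemma exp_pow_sub_exp_neg_pow (t : ℝ) (n : ℕ) :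
    Complex.exp (t * Complex.I) ^ (n : ℤ) - Complex.exp (t * Complex.I) ^ (-(n : ℤ)) =
      2 * Complex.I * (Real.sin (n * t) : ℂ) := by
  rw [← Complex.exp_int_mul, ← Complex.exp_int_mul, Complex.ofReal_sin, Complex.sin]
  push_cast
  rw [show (n : ℂ) * (t * Complex.I) = n * t * Complex.I by ring,
    show -(n : ℂ) * (t * Complex.I) = -(n * t) * Complex.I by ring]
  linear_combination (Complex.exp (n * t * Complex.I) - Complex.exp (-(n * t) * Complex.I)) *
    Complex.I_sq

lemma exp_sq_pow_sub_one (t : ℝ) (n : ℕ) :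
    (Complex.exp (t * Complex.I) ^ 2) ^ n - 1 =
      Complex.exp (t * Complex.I) ^ n * (2 * Complex.I * (Real.sin (n * t) : ℂ)) := by
  rw [← exp_pow_sub_exp_neg_pow, zpow_neg, zpow_natCast, mul_sub,
    mul_inv_cancel₀ (pow_ne_zero _ (Complex.exp_ne_zero _))]
  ring

lemma aeval_sinRelPoly_eq_zero_iff (k : ℤ) (t : ℝ) :
    Polynomial.aeval (Complex.exp (t * Complex.I) ^ 2) (sinRelPoly k) = 0 ↔ SinRel k t := by
  have h := exp_sq_pow_sub_one t
  have h1 := h 1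
  have h4 := h 4
  have h6 := h 6
  have h12 := h 12
  have h14 := h 14
  have h19 := h 19
  have hw : Complex.exp (t * Complex.I) ≠ 0 := Complex.exp_ne_zero _
  simp only [sinRelPoly, map_sub, map_mul, map_pow, Polynomial.aeval_X, map_one,
    Polynomial.aeval_C, SinRel]
  generalize Complex.exp (t * Complex.I) = w at *
  rw [h4, h6, h12, h14, h19, ← pow_one (w ^ 2), h1, ← Complex.ofReal_inj]
  push_cast
  have hc : w ^ 45 * (2 * Complex.I) ^ 3 ≠ 0 := by simp [hw]
  simp only [one_mul, pow_one, algebraMap_int_eq, eq_intCast]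
  refine ⟨fun h0 => mul_left_cancel₀ hc ?_, fun h0 => ?_⟩
  · linear_combination h0
  · linear_combination w ^ 45 * (2 * Complex.I) ^ 3 * h0

/-- Galois conjugation. -/
lemma SinRel.conj {k : ℤ} {ℓ a : ℕ} (hℓ : ℓ ≠ 0) (ha : a.Coprime ℓ)
    (h : SinRel k (Real.pi / ℓ)) : SinRel k (a * (Real.pi / ℓ)) := by
  rw [← aeval_sinRelPoly_eq_zero_iff] at h ⊢
  have hx : IsPrimitiveRoot
      (Complex.exp (((Real.pi / ℓ : ℝ) : ℂ) * Complex.I) ^ 2) ℓ := by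
    convert Complex.isPrimitiveRoot_exp ℓ hℓ using 1
    rw [← Complex.exp_nat_mul]
    push_cast
    congr 1
    ring
  have hpow : Complex.exp (((a * (Real.pi / ℓ) : ℝ) : ℂ) * Complex.I) ^ 2 =
      (Complex.exp (((Real.pi / ℓ : ℝ) : ℂ) * Complex.I) ^ 2) ^ a := by
    rw [← Complex.exp_nat_mul, ← Complex.exp_nat_mul, ← Complex.exp_nat_mul]
    push_cast
    congr 1
    ring
  have hint := hx.isIntegral (Nat.pos_of_ne_zero hℓ)
  have hdvd := minpoly.isIntegrallyClosed_dvd hint h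
  rw [hx.minpoly_eq_pow_coprime ha, ← hpow] at hdvd
  exact Polynomial.aeval_eq_zero_of_dvd_aeval_eq_zero hdvd (minpoly.aeval _ _)

lemma abs_cos_lt_cos {a b : ℝ} (ha : 0 ≤ a) (hab : a < b) (hb : b < Real.pi - a) :
    |Real.cos b| < Real.cos a := by
  rw [abs_lt, ← Real.cos_pi_sub]
  exact ⟨Real.cos_lt_cos_of_nonneg_of_le_pi (by linarith) (by linarith) hb,
    Real.cos_lt_cos_of_nonneg_of_le_pi ha (by linarith) hab⟩

lemma sin_le_sin_of_le_of_le_pi_sub {a b : ℝ} (ha : 0 ≤ a) (hab : a ≤ b)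
    (hb : b ≤ Real.pi - a) : Real.sin a ≤ Real.sin b := by
  rcases le_total b (Real.pi / 2) with h | h
  · exact Real.sin_le_sin_of_le_of_le_pi_div_two (by linarith [Real.pi_pos]) h hab
  · rw [← Real.sin_pi_sub b]
    exact Real.sin_le_sin_of_le_of_le_pi_div_two (by linarith [Real.pi_pos]) (by linarith)
      (by linarith)

lemma SinRel.pi_div_two_add {k : ℤ} {t : ℝ} (h : SinRel k (Real.pi / 2 + t)) :
    Real.sin (12 * t) * Real.sin (14 * t) * Real.cos (19 * t) =
      -k * (Real.sin (4 * t) * Real.sin (6 * t) * Real.cos t) := by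
  have e4 : Real.sin (4 * (Real.pi / 2 + t)) = Real.sin (4 * t) := by
    rw [← Real.sin_add_nat_mul_two_pi (4 * t) 1]; congr 1; push_cast; ring
  have e6 : Real.sin (6 * (Real.pi / 2 + t)) = -Real.sin (6 * t) := by
    rw [← Real.sin_add_pi, ← Real.sin_add_nat_mul_two_pi (6 * t + _) 1]; congr 1; push_cast; ring
  have e12 : Real.sin (12 * (Real.pi / 2 + t)) = Real.sin (12 * t) := by
    rw [← Real.sin_add_nat_mul_two_pi (12 * t) 3]; congr 1; push_cast; ring
  have e14 : Real.sin (14 * (Real.pi / 2 + t)) = -Real.sin (14 * t) := by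
    rw [← Real.sin_add_pi, ← Real.sin_add_nat_mul_two_pi (14 * t + _) 3]; congr 1; push_cast; ring
  have e19 : Real.sin (19 * (Real.pi / 2 + t)) = -Real.cos (19 * t) := by
    rw [← Real.sin_add_pi_div_two, ← Real.sin_add_pi,
      ← Real.sin_add_nat_mul_two_pi (19 * t + _ + _) 4]
    congr 1; push_cast; ring
  have e1 : Real.sin (Real.pi / 2 + t) = Real.cos t := by
    rw [add_comm, Real.sin_add_pi_div_two]
  rw [SinRel, e4, e6, e12, e14, e19, e1] at h
  linarith

lemma SinRel.not_two_mul {k : ℤ} {t : ℝ} (ht : 0 < t) (ht' : 21 * t ≤ Real.pi)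
    (h : SinRel k t) : ¬ SinRel k (2 * t) := by
  intro h2
  have dbl (n : ℝ) : Real.sin (n * (2 * t)) = 2 * Real.sin (n * t) * Real.cos (n * t) := by
    rw [← Real.sin_two_mul]; congr 1; ring
  rw [SinRel, dbl, dbl, dbl, dbl, dbl, Real.sin_two_mul] at h2
  rw [SinRel] at h
  have p12 : 0 < Real.sin (12 * t) := Real.sin_pos_of_pos_of_lt_pi (by linarith) (by linarith)
  have p14 : 0 < Real.sin (14 * t) := Real.sin_pos_of_pos_of_lt_pi (by linarith) (by linarith)
  have p19 : 0 < Real.sin (19 * t) := Real.sin_pos_of_pos_of_lt_pi (by linarith) (by linarith)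
  have hP := mul_pos (mul_pos p12 p14) p19
  have key : Real.cos (12 * t) * Real.cos (14 * t) * Real.cos (19 * t) =
      Real.cos (6 * t) * Real.cos (4 * t) * Real.cos t := by
    refine mul_left_cancel₀ hP.ne' ?_
    linear_combination h2 / 8 - Real.cos (6 * t) * Real.cos (4 * t) * Real.cos t * h
  have l12 := abs_cos_lt_cos (a := 6 * t) (b := 12 * t) (by linarith) (by linarith) (by linarith)
  have l14 := abs_cos_lt_cos (a := 4 * t) (b := 14 * t) (by linarith) (by linarith) (by linarith)
  have l19 := abs_cos_lt_cos (a := t) (b := 19 * t) (by linarith) (by linarith) (by linarith)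
  refine (lt_irrefl (Real.cos (6 * t) * Real.cos (4 * t) * Real.cos t)) ?_
  calc _ = Real.cos (12 * t) * Real.cos (14 * t) * Real.cos (19 * t) := key.symm
    _ ≤ |Real.cos (12 * t)| * |Real.cos (14 * t)| * |Real.cos (19 * t)| := by
      rw [← abs_mul, ← abs_mul]; exact le_abs_self _
    _ < _ := mul_lt_mul'' (mul_lt_mul'' l12 l14 (abs_nonneg _) (abs_nonneg _)) l19
      (by positivity) (abs_nonneg _)

lemma SinRel.not_pi_div_two_add_two_mul {k : ℤ} {t : ℝ} (ht : 0 < t) (ht' : 22 * t ≤ Real.pi)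
    (h : SinRel k t) : ¬ SinRel k (Real.pi / 2 + 2 * t) := by
  intro h2
  have h2 := h2.pi_div_two_add
  have dbl (n : ℝ) : Real.sin (n * (2 * t)) = 2 * Real.sin (n * t) * Real.cos (n * t) := by
    rw [← Real.sin_two_mul]; congr 1; ring
  rw [dbl, dbl, dbl, dbl] at h2
  rw [SinRel] at h
  have p12 : 0 < Real.sin (12 * t) := Real.sin_pos_of_pos_of_lt_pi (by linarith) (by linarith)
  have p14 : 0 < Real.sin (14 * t) := Real.sin_pos_of_pos_of_lt_pi (by linarith) (by linarith)
  have p1 : 0 < Real.sin t := Real.sin_pos_of_pos_of_lt_pi (by linarith) (by linarith)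
  have hP := mul_pos p12 p14
  have key : Real.cos (12 * t) * Real.cos (14 * t) * (Real.cos (19 * (2 * t)) * Real.sin t) =
      -(Real.cos (6 * t) * Real.cos (4 * t) * (Real.sin (19 * t) * Real.cos (2 * t))) := by
    refine mul_left_cancel₀ hP.ne' ?_
    linear_combination h2 * Real.sin t / 4 +
      Real.cos (6 * t) * Real.cos (4 * t) * Real.cos (2 * t) * h
  have l12 := abs_cos_lt_cos (a := 6 * t) (b := 12 * t) (by linarith) (by linarith) (by linarith)
  have l14 := abs_cos_lt_cos (a := 4 * t) (b := 14 * t) (by linarith) (by linarith) (by linarith)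
  have c2 : 0 < Real.cos (2 * t) := Real.cos_pos_of_mem_Ioo ⟨by linarith, by linarith⟩
  have s3 := sin_le_sin_of_le_of_le_pi_sub (a := 3 * t) (b := 19 * t)
    (by linarith) (by linarith) (by linarith)
  have s5 := sin_le_sin_of_le_of_le_pi_sub (a := t) (b := 5 * t)
    (by linarith) (by linarith) (by linarith)
  have s3c2 : Real.sin (3 * t) * Real.cos (2 * t) = (Real.sin (5 * t) + Real.sin t) / 2 := by
    rw [show 5 * t = 3 * t + 2 * t by ring, show Real.sin t = Real.sin (3 * t - 2 * t) by ring_nf,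
      Real.sin_add, Real.sin_sub]
    ring
  have l19 : |Real.cos (19 * (2 * t)) * Real.sin t| ≤ Real.sin (19 * t) * Real.cos (2 * t) := by
    rw [abs_mul, abs_of_pos p1]
    nlinarith [Real.abs_cos_le_one (19 * (2 * t))]
  have hpos : 0 < Real.sin (19 * t) * Real.cos (2 * t) := by nlinarith
  have habs := congrArg abs key
  rw [abs_neg, abs_mul, abs_mul, abs_mul (_ * _) (_ * _),
    abs_of_pos (mul_pos ((abs_nonneg _).trans_lt l12) ((abs_nonneg _).trans_lt l14)),
    abs_of_pos hpos] at habs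
  refine habs.not_lt ?_
  calc _ ≤ |Real.cos (12 * t)| * |Real.cos (14 * t)| * (Real.sin (19 * t) * Real.cos (2 * t)) :=
        mul_le_mul_of_nonneg_left l19 (by positivity)
    _ < _ := mul_lt_mul_of_pos_right (mul_lt_mul'' l12 l14 (abs_nonneg _) (abs_nonneg _)) hpos

lemma SinRel.not_pi_div_two_add {k : ℤ} {t : ℝ} (ht : 0 < t) (ht' : 20 * t < Real.pi)
    (h : SinRel k t) : ¬ SinRel k (Real.pi / 2 + t) := by
  intro h2
  have h2 := h2.pi_div_two_add
  rw [SinRel] at h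
  have p12 : 0 < Real.sin (12 * t) := Real.sin_pos_of_pos_of_lt_pi (by linarith) (by linarith)
  have p14 : 0 < Real.sin (14 * t) := Real.sin_pos_of_pos_of_lt_pi (by linarith) (by linarith)
  have p20 : 0 < Real.sin (19 * t + t) := Real.sin_pos_of_pos_of_lt_pi (by linarith) (by linarith)
  rw [Real.sin_add] at p20
  have := mul_pos (mul_pos p12 p14) p20
  refine this.ne' ?_
  linear_combination h2 * Real.sin t + h * Real.cos t

lemma not_sinRel_pi_div_twenty (k : ℤ) : ¬ SinRel k (Real.pi / 20) := by
  intro h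
  have hpi := Real.pi_pos
  rw [SinRel, show 12 * (Real.pi / 20) = Real.pi - 2 * (Real.pi / 5) by ring,
    show 14 * (Real.pi / 20) = Real.pi - 6 * (Real.pi / 20) by ring,
    show 19 * (Real.pi / 20) = Real.pi - Real.pi / 20 by ring, Real.sin_pi_sub, Real.sin_pi_sub,
    Real.sin_pi_sub, Real.sin_two_mul, show 4 * (Real.pi / 20) = Real.pi / 5 by ring] at h
  have p1 : 0 < Real.sin (Real.pi / 20) :=
    Real.sin_pos_of_pos_of_lt_pi (by linarith) (by linarith)
  have p4 : 0 < Real.sin (Real.pi / 5) :=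
    Real.sin_pos_of_pos_of_lt_pi (by linarith) (by linarith)
  have p6 : 0 < Real.sin (6 * (Real.pi / 20)) :=
    Real.sin_pos_of_pos_of_lt_pi (by linarith) (by linarith)
  have hk : 2 * Real.cos (Real.pi / 5) = k := by
    refine mul_left_cancel₀ (mul_pos (mul_pos p4 p6) p1).ne' ?_
    linear_combination h
  have h1 : Real.cos (Real.pi / 3) < Real.cos (Real.pi / 5) :=
    Real.cos_lt_cos_of_nonneg_of_le_pi (by linarith) (by linarith) (by linarith)
  have h2 : Real.cos (Real.pi / 5) < Real.cos 0 :=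
    Real.cos_lt_cos_of_nonneg_of_le_pi le_rfl (by linarith) (by linarith)
  rw [Real.cos_pi_div_three] at h1
  rw [Real.cos_zero] at h2
  have k1 : (1 : ℝ) < k := by linarith
  have k2 : (k : ℝ) < 2 := by linarith
  norm_cast at k1 k2
  omega

lemma not_sinRel_pi_div {ℓ : ℕ} (hℓ : 20 ≤ ℓ) (k : ℤ) : ¬ SinRel k (Real.pi / ℓ) := by
  intro h
  have hpi := Real.pi_pos
  have hℓ0 : ℓ ≠ 0 := by omega
  have ht : 0 < Real.pi / ℓ := by positivity
  have hb {c : ℕ} (hc : c ≤ ℓ) : c * (Real.pi / ℓ) ≤ Real.pi := by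
    rw [← mul_div_assoc, div_le_iff₀ (by positivity), mul_comm]
    gcongr
  rcases hℓ.eq_or_lt with rfl | hℓ
  · exact not_sinRel_pi_div_twenty k (by simpa using h)
  have h21 : 21 * (Real.pi / ℓ) ≤ Real.pi := by exact_mod_cast hb (c := 21) hℓ
  rcases Nat.even_or_odd' ℓ with ⟨m, hm | hm⟩
  · have hmt : (m : ℝ) * (Real.pi / ℓ) = Real.pi / 2 := by
      have : (m : ℝ) ≠ 0 := by norm_cast; omega
      rw [hm]; push_cast; field_simp
    rcases Nat.even_or_odd' m with ⟨n, hn | hn⟩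
    · have hco : (m + 1).Coprime ℓ := by
        rw [hm]
        refine Nat.Coprime.mul_right ?_ (by simp)
        rw [Nat.coprime_two_right]
        exact ⟨n, by omega⟩
      refine h.not_pi_div_two_add ht (by linarith) ?_
      convert h.conj hℓ0 hco using 1
      push_cast
      linarith
    · have hco : (m + 2).Coprime ℓ := by
        have hodd : Odd (m + 2) := ⟨n + 1, by omega⟩
        have hoddm : Odd m := ⟨n, hn⟩
        rw [hm]
        refine Nat.Coprime.mul_right (Nat.coprime_two_right.2 hodd) ?_
        simpa using Nat.coprime_two_left.2 hoddm
      refine h.not_pi_div_two_add_two_mul ht (by exact_mod_cast hb (c := 22) (by omega)) ?_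
      convert h.conj hℓ0 hco using 1
      push_cast
      linarith
  · have hco : Nat.Coprime 2 ℓ := Nat.coprime_two_left.2 ⟨m, hm⟩
    exact h.not_two_mul ht h21 (by exact_mod_cast h.conj hℓ0 hco)

/-- For `ℓ ≥ 20` and `q = e^{iπ/ℓ}`, the quantity `[12]_q[14]_q[19]_q/([4]_q[6]_q)`
is not a rational integer. -/
theorem stmt_5 (ℓ : ℕ) (hℓ : 20 ≤ ℓ)
    (q : ℂ) (hq : q = Complex.exp (Real.pi * Complex.I / (ℓ : ℂ))) :
    ¬ ∃ k : ℤ, qint q 12 * qint q 14 * qint q 19 / (qint q 4 * qint q 6) = (k : ℂ) := by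
  rintro ⟨k, hk⟩
  refine not_sinRel_pi_div hℓ k ?_
  have hsin {n : ℕ} (hn : 0 < n) (hn' : n < ℓ) : (Real.sin (n * (Real.pi / ℓ)) : ℂ) ≠ 0 := by
    have hℓ0 : (0 : ℝ) < ℓ := by norm_cast; omega
    have hnR : (n : ℝ) < ℓ := by exact_mod_cast hn'
    refine Complex.ofReal_ne_zero.2 (Real.sin_pos_of_pos_of_lt_pi (by positivity) ?_).ne'
    rw [← mul_div_assoc, div_lt_iff₀ hℓ0, mul_comm]
    exact mul_lt_mul_of_pos_left hnR Real.pi_pos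
  have hq' : q = Complex.exp (((Real.pi / ℓ : ℝ) : ℂ) * Complex.I) := by
    rw [hq]; push_cast; congr 1; ring
  have hqint (n : ℕ) : qint q n =
      (Real.sin (n * (Real.pi / ℓ)) : ℂ) / (Real.sin ((1 : ℕ) * (Real.pi / ℓ)) : ℂ) := by
    have h1 := exp_pow_sub_exp_neg_pow (Real.pi / ℓ) 1
    rw [← hq', Nat.cast_one, zpow_one, zpow_neg_one] at h1
    rw [qint, h1, hq', exp_pow_sub_exp_neg_pow, mul_div_mul_left _ _ (by simp), Nat.cast_one]
  have s1 := hsin (n := 1) (by omega) (by omega)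
  have s4 := hsin (n := 4) (by omega) (by omega)
  have s6 := hsin (n := 6) (by omega) (by omega)
  simp only [hqint] at hk
  rw [SinRel, ← Complex.ofReal_inj]
  push_cast [-Complex.ofReal_sin] at hk s1 s4 s6 ⊢
  rw [one_mul] at hk s1
  generalize Complex.ofReal (Real.sin (4 * (Real.pi / ℓ))) = a4 at *
  generalize Complex.ofReal (Real.sin (6 * (Real.pi / ℓ))) = a6 at *
  generalize Complex.ofReal (Real.sin (12 * (Real.pi / ℓ))) = a12 at *
  generalize Complex.ofReal (Real.sin (14 * (Real.pi / ℓ))) = a14 at *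
  generalize Complex.ofReal (Real.sin (19 * (Real.pi / ℓ))) = a19 at *
  field_simp at hk
  linear_combination hk
end

section
/- Let ℓ ≥ 18 be an integer and q = e^{iπ/ℓ}. The least positive integer t such that (q^{−12})^t = (−q^{−6})^t = (−1)^t = (q^2)^t equals ℓ if ℓ is even and equals 2ℓ if ℓ is odd. -/
/-- If `q ^ 2` is a primitive `n`-th root of unity, then `q⁻¹²`, `-q⁻⁶`, `-1` and `q²` have equal
`t`-th powers exactly when `t` is an even multiple of `n`. -/
lemma pow_eq_iff_even_and_dvd {n : ℕ} {q : ℂ} (hq : IsPrimitiveRoot (q ^ 2) n) (t : ℕ) :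
    ((q ^ (-12 : ℤ)) ^ t = (-q ^ (-6 : ℤ)) ^ t ∧ (-q ^ (-6 : ℤ)) ^ t = (-1 : ℂ) ^ t ∧
      (-1 : ℂ) ^ t = (q ^ (2 : ℤ)) ^ t) ↔ Even t ∧ n ∣ t := by
  have h12 : q ^ (-12 : ℤ) = ((q ^ (-6 : ℤ)) ^ 2) := by
    rw [← zpow_natCast, ← zpow_mul]; norm_num
  have h6 : q ^ (-6 : ℤ) = ((q ^ 2) ^ 3)⁻¹ := by
    rw [← pow_mul, zpow_neg]; norm_cast
  have h2 : q ^ (2 : ℤ) = q ^ 2 := by norm_cast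
  rw [h12, h2, ← hq.pow_eq_one_iff_dvd, neg_pow (q ^ (-6 : ℤ)), pow_right_comm]
  constructor
  · rintro ⟨h₁, h₂, h₃⟩
    have hx : (q ^ (-6 : ℤ)) ^ t = 1 := by
      simpa using h₂
    have ht : (-1 : ℂ) ^ t = 1 := by
      rw [hx, one_pow, mul_one] at h₁
      exact h₁.symm
    exact ⟨(neg_one_pow_eq_one_iff_even (by norm_num)).1 ht, h₃.symm.trans ht⟩
  · rintro ⟨ht, h⟩
    have hx : (q ^ (-6 : ℤ)) ^ t = 1 := by
      rw [h6, inv_pow, pow_right_comm, h, one_pow, inv_one]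
    rw [hx, h, ht.neg_one_pow]
    norm_num

/-- For `ℓ ≥ 18` and `q = e^{iπ/ℓ}`, the least positive integer `t` with
`(q^{-12})^t = (-q^{-6})^t = (-1)^t = (q^2)^t` is `ℓ` if `ℓ` is even and `2ℓ`
if `ℓ` is odd. -/
theorem stmt_10 (ℓ : ℕ) (hℓ : 18 ≤ ℓ)
    (q : ℂ) (hq : q = Complex.exp (Real.pi * Complex.I / (ℓ : ℂ))) :
    IsLeast {t : ℕ | 0 < t ∧ (q ^ (-12 : ℤ)) ^ t = (-q ^ (-6 : ℤ)) ^ t ∧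
        (-q ^ (-6 : ℤ)) ^ t = (-1 : ℂ) ^ t ∧ (-1 : ℂ) ^ t = (q ^ (2 : ℤ)) ^ t}
      (if Even ℓ then ℓ else 2 * ℓ) := by
  have hprim : IsPrimitiveRoot (q ^ 2) ℓ := by
    have h := Complex.isPrimitiveRoot_exp ℓ (by omega)
    rwa [show 2 * (Real.pi : ℂ) * Complex.I / ℓ = (2 : ℕ) * (Real.pi * Complex.I / ℓ) by
      push_cast; ring, Complex.exp_nat_mul, ← hq] at h
  simp only [pow_eq_iff_even_and_dvd hprim]
  split_ifs with he
  · exact ⟨⟨by omega, he, dvd_rfl⟩, fun t ht => Nat.le_of_dvd ht.1 ht.2.2⟩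
  · refine ⟨⟨by omega, even_two_mul ℓ, dvd_mul_left ℓ 2⟩, fun t ht => Nat.le_of_dvd ht.1 ?_⟩
    exact (Nat.coprime_two_left.2 (Nat.not_even_iff_odd.1 he)).mul_dvd_of_dvd_of_dvd
      ht.2.1.two_dvd ht.2.2
end

section
/- Let ℓ ≥ 18 be an integer, q = e^{iπ/ℓ}, and let S = {q^{−12}, −q^{−6}, −1, q^2} ⊂ ℂ. Then: (a) there do not exist complex numbers r, s with S = {r, −r, s, −s}; and (b) with ω = e^{2πi/3}, there is no complex number χ such that {−1, q^{−12}, −q^{−6}} = {χ, χω, χω^2}. -/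
theorem isPrimitiveRoot_exp_pi_mul_I_div {n : ℕ} (hn : n ≠ 0) :
    IsPrimitiveRoot (Complex.exp (Real.pi * Complex.I / (n : ℂ))) (2 * n) := by
  convert Complex.isPrimitiveRoot_exp (2 * n) (by positivity) using 2
  push_cast
  field_simp

/-- For `ℓ ≥ 18` and `q = e^{iπ/ℓ}`, with `S = {q^{-12}, -q^{-6}, -1, q^2}`:
(a) `S` is not of the form `{r, -r, s, -s}`; and (b) with `ω = e^{2πi/3}`,
the set `{-1, q^{-12}, -q^{-6}}` is not a coset `{χ, χω, χω²}` of the cube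
roots of unity. -/
theorem stmt_11 (ℓ : ℕ) (hℓ : 18 ≤ ℓ)
    (q : ℂ) (hq : q = Complex.exp (Real.pi * Complex.I / (ℓ : ℂ)))
    (ω : ℂ) (hω : ω = Complex.exp (2 * Real.pi * Complex.I / 3)) :
    (¬ ∃ r s : ℂ,
        ({q ^ (-12 : ℤ), -q ^ (-6 : ℤ), -1, q ^ (2 : ℤ)} : Set ℂ) = {r, -r, s, -s}) ∧
    (¬ ∃ χ : ℂ,
        ({-1, q ^ (-12 : ℤ), -q ^ (-6 : ℤ)} : Set ℂ) = {χ, χ * ω, χ * ω ^ 2}) := by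
  have hprim : IsPrimitiveRoot q (2 * ℓ) := hq ▸ isPrimitiveRoot_exp_pi_mul_I_div (by lia)
  have hpow (k : ℕ) (hk : k ≠ 0) (hk' : k ≤ 18) : q ^ k ≠ 1 :=
    hprim.pow_ne_one_of_pos_of_lt hk (by lia)
  have hω3 : ω ^ 3 = 1 := by
    simpa [hω] using (Complex.isPrimitiveRoot_exp 3 (by norm_num)).pow_eq_one
  have h6 : q ^ (-6 : ℤ) = (q ^ 6)⁻¹ := by rw [zpow_neg]; norm_cast
  have h12 : q ^ (-12 : ℤ) = (q ^ 12)⁻¹ := by rw [zpow_neg]; norm_cast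
  have h2 : q ^ (2 : ℤ) = q ^ 2 := by norm_cast
  rw [h6, h12, h2]
  constructor
  · rintro ⟨r, s, h⟩
    have hneg : (-1 : ℂ) ∈ ({r, -r, s, -s} : Set ℂ) := h ▸ by simp
    have hone : (1 : ℂ) ∈ ({r, -r, s, -s} : Set ℂ) := by
      simp only [Set.mem_insert_iff, Set.mem_singleton_iff] at hneg ⊢
      grind
    rw [← h] at hone
    rcases hone with h1 | h1 | h1 | h1
    · exact hpow 12 (by norm_num) (by norm_num) (inv_eq_one.mp h1.symm)
    · refine hpow 12 (by norm_num) (by norm_num) ?_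
      have hq6 : q ^ 6 = -1 := by rw [← inv_inv (q ^ 6), ← neg_eq_iff_eq_neg.mpr h1]; norm_num
      linear_combination (q ^ 6 - 1) * hq6
    · norm_num at h1
    · exact hpow 2 (by norm_num) (by norm_num) h1.symm
  · rintro ⟨χ, h⟩
    have hcube (z : ℂ) (hz : z ∈ ({χ, χ * ω, χ * ω ^ 2} : Set ℂ)) : z ^ 3 = χ ^ 3 := by
      rcases hz with rfl | rfl | rfl
      · rfl
      · rw [mul_pow, hω3, mul_one]
      · rw [mul_pow, pow_right_comm, hω3, one_pow, mul_one]
    have hχ := (hcube (-(q ^ 6)⁻¹) (h ▸ by simp)).trans (hcube (-1) (h ▸ by simp)).symm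
    refine hpow 18 (by norm_num) le_rfl (inv_eq_one.mp ?_)
    rw [show q ^ 18 = (q ^ 6) ^ 3 by ring, ← inv_pow]
    linear_combination -hχ
end

section
/- Let q = e^{iπ/24} and let A, B ∈ GL_4(ℂ) be the explicit matrices given below. Then for every positive integer j, the matrix (AB^{−1})^j is not a scalar multiple of the identity matrix; in particular AB^{−1} has infinite order and the subgroup of GL_4(ℂ) generated by A and B is infinite. -/
/-- The trace of a complex square matrix of finite order is bounded by its size. -/
theorem norm_trace_le_of_pow_eq_one {n : ℕ} (X : Matrix (Fin n) (Fin n) ℂ) {k : ℕ}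
    (hk : 0 < k) (hX : X ^ k = 1) : ‖X.trace‖ ≤ n := by
  have hroot : ∀ z ∈ X.charpoly.roots, ‖z‖ = 1 := by
    intro z hz
    have hev : Module.End.HasEigenvalue (Matrix.toLin' X) z := by
      rw [Module.End.hasEigenvalue_iff_isRoot_charpoly, Matrix.charpoly_toLin']
      exact Polynomial.isRoot_of_mem_roots hz
    obtain ⟨v, hv⟩ := hev.exists_hasEigenvector
    have hpow := hv.pow_apply k
    rw [← Matrix.toLin'_pow, hX, Matrix.toLin'_one, LinearMap.id_apply] at hpow
    have hz1 : z ^ k = 1 := by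
      have h0 : (z ^ k - 1) • v = 0 := by rw [sub_smul, ← hpow, one_smul, sub_self]
      exact sub_eq_zero.mp ((smul_eq_zero.mp h0).resolve_right hv.2)
    exact Complex.norm_eq_one_of_pow_eq_one hz1 hk.ne'
  rw [Matrix.trace_eq_sum_roots_charpoly]
  refine (norm_multiset_sum_le _).trans ?_
  rw [Multiset.map_congr rfl hroot, Multiset.map_const', Multiset.sum_replicate, nsmul_eq_mul,
    mul_one]
  have hcard := X.charpoly.card_roots'
  rw [Matrix.charpoly_natDegree_eq_dim, Fintype.card_fin] at hcard
  exact_mod_cast hcard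

/-- A complex matrix of determinant one whose square has trace of modulus larger than its size
has no scalar positive power. -/
theorem pow_ne_smul_one_of_lt_norm_trace_sq {n : ℕ} (hn : n ≠ 0) {X : Matrix (Fin n) (Fin n) ℂ}
    (hdet : X.det = 1) (htr : (n : ℝ) < ‖(X ^ 2).trace‖) {j : ℕ} (hj : 0 < j) (c : ℂ) :
    X ^ j ≠ c • (1 : Matrix (Fin n) (Fin n) ℂ) := by
  intro h
  have hc : c ^ n = 1 := by
    have hd := congrArg Matrix.det h
    rw [Matrix.det_pow, hdet, one_pow, Matrix.det_smul, Matrix.det_one, mul_one,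
      Fintype.card_fin] at hd
    exact hd.symm
  refine htr.not_ge (norm_trace_le_of_pow_eq_one (X ^ 2) (Nat.mul_pos hj hn.bot_lt) ?_)
  rw [← pow_mul, mul_comm 2, pow_mul, pow_mul, h, smul_pow, one_pow, hc, one_smul, one_pow]

/-- A submonoid containing a unit of infinite order is infinite. -/
theorem Submonoid.infinite_of_mem_of_pow_ne_one {M : Type*} [Monoid M] (S : Submonoid M) {x : M}
    (hx : x ∈ S) (hu : IsUnit x) (h : ∀ j : ℕ, 0 < j → x ^ j ≠ 1) : (S : Set M).Infinite := by
  refine Set.infinite_of_injective_forall_mem (f := fun k : ℕ => x ^ k) ?_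
    fun k => S.pow_mem hx k
  have key : ∀ a b : ℕ, a < b → x ^ a ≠ x ^ b := by
    intro a b hab heq
    refine h (b - a) (Nat.sub_pos_of_lt hab) ((hu.pow a).mul_left_cancel ?_)
    rw [← pow_add, Nat.add_sub_cancel' hab.le, mul_one, heq]
  intro a b hab
  by_contra hne
  rcases Nat.lt_or_gt_of_ne hne with hlt | hlt
  · exact key a b hlt hab
  · exact key b a hlt hab.symm

section Generators

/-- The polynomial form of the first generator, valid when `q` is a root of `x ^ 16 - x ^ 8 + 1`. -/
def upperGenerator (q : ℂ) : Matrix (Fin 4) (Fin 4) ℂ :=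
  !![-q ^ 12, 2 * q ^ 2 + q ^ 6 - q ^ 10 - q ^ 14, -(q ^ 2 - 2 * q ^ 10 - q ^ 14), -1;
    0, q ^ 2, -(q ^ 2 - q ^ 10 + q ^ 14), -1;
    0, 0, -(q ^ 2 - q ^ 10), -1;
    0, 0, 0, -1]

/-- The polynomial form of the second generator, valid when `q` is a root of `x ^ 16 - x ^ 8 + 1`. -/
def lowerGenerator (q : ℂ) : Matrix (Fin 4) (Fin 4) ℂ :=
  !![-1, 0, 0, 0;
    q ^ 2 - q ^ 10, -(q ^ 2 - q ^ 10), 0, 0;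
    q ^ 6, -((q ^ 4 + 1) * q ^ 2), q ^ 2, 0;
    -1, 2 + q ^ 4 - q ^ 8 - q ^ 12, -(1 + q ^ 4 - q ^ 8 - 2 * q ^ 12), -q ^ 12]

/-- The inverse of `lowerGenerator q` when `q` is a root of `x ^ 16 - x ^ 8 + 1`. -/
def lowerGeneratorInv (q : ℂ) : Matrix (Fin 4) (Fin 4) ℂ :=
  !![-1, 0, 0, 0;
    -1, -q ^ 6, 0, 0;
    -1, -q ^ 6 - q ^ 10, q ^ 6 - q ^ 14, 0;
    -1, -q ^ 6 - q ^ 10 - q ^ 14, q ^ 2 + 2 * q ^ 6 - q ^ 14, q ^ 12]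

/-- The product of `upperGenerator q` and `lowerGeneratorInv q` when `q` is a root of
`x ^ 16 - x ^ 8 + 1`. -/
def generatorQuotient (q : ℂ) : Matrix (Fin 4) (Fin 4) ℂ :=
  !![1 - q ^ 2 - q ^ 6 - q ^ 10 + q ^ 12,
      2 + 2 * q ^ 4 + q ^ 6 - 2 * q ^ 8 + q ^ 10 - 2 * q ^ 12 + q ^ 14,
      -1 - q ^ 2 - 2 * q ^ 6 + 2 * q ^ 8 + q ^ 12 + q ^ 14, -q ^ 12;
    1 - q ^ 10 + q ^ 14, q ^ 6 - q ^ 8 + q ^ 10 + q ^ 12 + q ^ 14,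
      -1 - q ^ 2 - 2 * q ^ 6 + q ^ 8 - q ^ 12 + q ^ 14, -q ^ 12;
    1 + q ^ 2 - q ^ 10, 1 + q ^ 4 + q ^ 6 + q ^ 10 + q ^ 14,
      -1 - q ^ 2 - 2 * q ^ 6 + q ^ 8 + q ^ 14, -q ^ 12;
    1, q ^ 6 + q ^ 10 + q ^ 14, -q ^ 2 - 2 * q ^ 6 + q ^ 14, -q ^ 12]

variable {q : ℂ}

theorem zpow_neg_twelve_eq (hq : q ^ 16 = q ^ 8 - 1) : q ^ (-12 : ℤ) = -q ^ 12 := by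
  rw [zpow_neg]
  refine inv_eq_of_mul_eq_one_right ?_
  norm_cast
  linear_combination (-q ^ 8 - 1) * hq

theorem zpow_neg_six_eq (hq : q ^ 16 = q ^ 8 - 1) : q ^ (-6 : ℤ) = q ^ 2 - q ^ 10 := by
  rw [zpow_neg]
  refine inv_eq_of_mul_eq_one_right ?_
  norm_cast
  linear_combination -hq

theorem upperGenerator_eq (hq : q ^ 16 = q ^ 8 - 1) (h0 : q ≠ 0) :
    !![q ^ (-12 : ℤ), (q ^ 8 + q ^ 4 + 1) / q ^ 6,
          -((q ^ 8 + q ^ 4 + 1) / q ^ 14), -1;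
        0, q ^ 2, -((q ^ 4 - 1) / q ^ 10), -1;
        0, 0, -q ^ (-6 : ℤ), -1;
        0, 0, 0, -1] = upperGenerator q := by
  have h1 : (q ^ 8 + q ^ 4 + 1) / q ^ 6 = 2 * q ^ 2 + q ^ 6 - q ^ 10 - q ^ 14 := by
    rw [div_eq_iff (pow_ne_zero 6 h0)]
    grind
  have h2 : (q ^ 8 + q ^ 4 + 1) / q ^ 14 = q ^ 2 - 2 * q ^ 10 - q ^ 14 := by
    rw [div_eq_iff (pow_ne_zero 14 h0)]
    grind
  have h3 : (q ^ 4 - 1) / q ^ 10 = q ^ 2 - q ^ 10 + q ^ 14 := by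
    rw [div_eq_iff (pow_ne_zero 10 h0)]
    linear_combination (q ^ 4 - 1 - q ^ 8) * hq
  rw [zpow_neg_twelve_eq hq, zpow_neg_six_eq hq, h1, h2, h3, upperGenerator]

theorem lowerGenerator_eq (hq : q ^ 16 = q ^ 8 - 1) (h0 : q ≠ 0) :
    !![-1, 0, 0, 0;
        q ^ (-6 : ℤ), -q ^ (-6 : ℤ), 0, 0;
        q ^ 6, -((q ^ 4 + 1) * q ^ 2), q ^ 2, 0;
        -1, (q ^ 8 + q ^ 4 + 1) / q ^ 8, -((q ^ 8 + q ^ 4 + 1) / q ^ 12),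
          q ^ (-12 : ℤ)] = lowerGenerator q := by
  have h1 : (q ^ 8 + q ^ 4 + 1) / q ^ 8 = 2 + q ^ 4 - q ^ 8 - q ^ 12 := by
    rw [div_eq_iff (pow_ne_zero 8 h0)]
    grind
  have h2 : (q ^ 8 + q ^ 4 + 1) / q ^ 12 = 1 + q ^ 4 - q ^ 8 - 2 * q ^ 12 := by
    rw [div_eq_iff (pow_ne_zero 12 h0)]
    grind
  rw [zpow_neg_twelve_eq hq, zpow_neg_six_eq hq, h1, h2, lowerGenerator]

theorem lowerGeneratorInv_mul (hq : q ^ 16 = q ^ 8 - 1) :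
    lowerGeneratorInv q * lowerGenerator q = 1 := by
  ext i j
  fin_cases i <;> fin_cases j <;>
    simp [lowerGeneratorInv, lowerGenerator, Matrix.mul_apply, Fin.sum_univ_succ] <;> grind

theorem upperGenerator_mul_lowerGeneratorInv (hq : q ^ 16 = q ^ 8 - 1) :
    upperGenerator q * lowerGeneratorInv q = generatorQuotient q := by
  ext i j
  fin_cases i <;> fin_cases j <;>
    simp [upperGenerator, lowerGeneratorInv, generatorQuotient, Matrix.mul_apply,
      Fin.sum_univ_succ] <;> grind

theorem det_upperGenerator (hq : q ^ 16 = q ^ 8 - 1) : (upperGenerator q).det = -q ^ 8 := by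
  rw [Matrix.det_of_isUpperTriangular]
  · simp [upperGenerator, Fin.prod_univ_succ]
    grind
  · intro i j hij
    fin_cases i <;> fin_cases j <;> simp_all [upperGenerator]

theorem det_lowerGeneratorInv (hq : q ^ 16 = q ^ 8 - 1) :
    (lowerGeneratorInv q).det = q ^ 8 - 1 := by
  rw [Matrix.det_of_isLowerTriangular]
  · simp [lowerGeneratorInv, Fin.prod_univ_succ]
    grind
  · intro i j hij
    replace hij : i < j := hij
    fin_cases i <;> fin_cases j <;> simp_all [lowerGeneratorInv]

theorem det_generatorQuotient (hq : q ^ 16 = q ^ 8 - 1) : (generatorQuotient q).det = 1 := by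
  rw [← upperGenerator_mul_lowerGeneratorInv hq, Matrix.det_mul, det_upperGenerator hq,
    det_lowerGeneratorInv hq]
  grind

theorem trace_generatorQuotient_sq (hq : q ^ 16 = q ^ 8 - 1) :
    (generatorQuotient q ^ 2).trace =
      -3 - 4 * q ^ 2 - 4 * q ^ 6 - 2 * q ^ 12 - 4 * q ^ 14 := by
  simp [generatorQuotient, pow_two (M := Matrix (Fin 4) (Fin 4) ℂ), Matrix.trace,
    Fin.sum_univ_succ]
  grind

end Generators

theorem re_exp_pi_mul_I_div_pow (n : ℕ) :
    (Complex.exp (Real.pi * Complex.I / 24) ^ n).re = Real.cos (n * Real.pi / 24) := by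
  rw [← Complex.exp_nat_mul,
    show (n : ℂ) * (Real.pi * Complex.I / 24) = ((n * Real.pi / 24 : ℝ) : ℂ) * Complex.I by
      push_cast; ring,
    Complex.exp_ofReal_mul_I_re]

theorem exp_pi_mul_I_div_pow_sixteen :
    Complex.exp (Real.pi * Complex.I / 24) ^ 16 =
      Complex.exp (Real.pi * Complex.I / 24) ^ 8 - 1 := by
  have h : (8 : ℕ) * (Real.pi * Complex.I / 24) = ((Real.pi / 3 : ℝ) : ℂ) * Complex.I := by
    push_cast; ring
  have h8 : Complex.exp (Real.pi * Complex.I / 24) ^ 8 = 1 / 2 + (√3 / 2 : ℝ) * Complex.I := by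
    rw [← Complex.exp_nat_mul, h, Complex.exp_mul_I, ← Complex.ofReal_cos, ← Complex.ofReal_sin,
      Real.cos_pi_div_three, Real.sin_pi_div_three]
    push_cast; ring
  have h3 : ((√3 : ℝ) : ℂ) ^ 2 = 3 := by
    norm_cast
    simp
  rw [show 16 = 8 * 2 from rfl, pow_mul, h8]
  push_cast
  linear_combination (1 / 4 : ℂ) * Complex.I ^ 2 * h3 + (3 / 4 : ℂ) * Complex.I_sq

theorem four_lt_norm_trace_generatorQuotient_sq :
    4 < ‖(generatorQuotient (Complex.exp (Real.pi * Complex.I / 24)) ^ 2).trace‖ := by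
  rw [trace_generatorQuotient_sq exp_pi_mul_I_div_pow_sixteen]
  set q := Complex.exp (Real.pi * Complex.I / 24) with hq
  have h6 : Real.cos ((6 : ℕ) * Real.pi / 24) = √2 / 2 := by
    rw [← Real.cos_pi_div_four]; congr 1; push_cast; ring
  have h12 : Real.cos ((12 : ℕ) * Real.pi / 24) = 0 := by
    rw [← Real.cos_pi_div_two]; congr 1; push_cast; ring
  have h14 : -Real.cos ((2 : ℕ) * Real.pi / 24) ≤ Real.cos ((14 : ℕ) * Real.pi / 24) := by
    have hpi := Real.pi_pos
    rw [← Real.cos_pi_sub]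
    apply Real.cos_le_cos_of_nonneg_of_le_pi <;> push_cast <;> linarith
  have hs : (1 : ℝ) < √2 := by
    rw [Real.lt_sqrt] <;> norm_num
  have hre : (-3 - 4 * q ^ 2 - 4 * q ^ 6 - 2 * q ^ 12 - 4 * q ^ 14).re < -4 := by
    have hr : (-3 - 4 * q ^ 2 - 4 * q ^ 6 - 2 * q ^ 12 - 4 * q ^ 14).re =
        -3 - 4 * (q ^ 2).re - 4 * (q ^ 6).re - 2 * (q ^ 12).re - 4 * (q ^ 14).re := by
      simp
    rw [hr, hq, re_exp_pi_mul_I_div_pow, re_exp_pi_mul_I_div_pow, re_exp_pi_mul_I_div_pow,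
      re_exp_pi_mul_I_div_pow, h6, h12]
    linarith
  exact (lt_neg_of_lt_neg hre).trans_le ((neg_le_abs _).trans (Complex.abs_re_le_norm _))


/-- For `q = e^{iπ/24}` and the explicit Tuba–Wenzl matrices `A`, `B`, every
positive power of `AB⁻¹` is non-scalar; in particular `AB⁻¹` has infinite
order and the group generated by `A` and `B` is infinite. -/
theorem stmt_12 (q : ℂ) (hq : q = Complex.exp (Real.pi * Complex.I / 24))
    (A B : Matrix (Fin 4) (Fin 4) ℂ)
    (hA : A = !![q ^ (-12 : ℤ), (q ^ 8 + q ^ 4 + 1) / q ^ 6,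
          -((q ^ 8 + q ^ 4 + 1) / q ^ 14), -1;
        0, q ^ 2, -((q ^ 4 - 1) / q ^ 10), -1;
        0, 0, -q ^ (-6 : ℤ), -1;
        0, 0, 0, -1])
    (hB : B = !![-1, 0, 0, 0;
        q ^ (-6 : ℤ), -q ^ (-6 : ℤ), 0, 0;
        q ^ 6, -((q ^ 4 + 1) * q ^ 2), q ^ 2, 0;
        -1, (q ^ 8 + q ^ 4 + 1) / q ^ 8, -((q ^ 8 + q ^ 4 + 1) / q ^ 12),
          q ^ (-12 : ℤ)]) :
    (∀ j : ℕ, 0 < j → ∀ c : ℂ,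
        (A * B⁻¹) ^ j ≠ c • (1 : Matrix (Fin 4) (Fin 4) ℂ)) ∧
    (∀ j : ℕ, 0 < j → (A * B⁻¹) ^ j ≠ 1) ∧
    Set.Infinite
      ((Submonoid.closure ({A, B, A⁻¹, B⁻¹} : Set (Matrix (Fin 4) (Fin 4) ℂ))
        : Submonoid (Matrix (Fin 4) (Fin 4) ℂ)) : Set (Matrix (Fin 4) (Fin 4) ℂ)) := by
  subst hq
  have hq := exp_pi_mul_I_div_pow_sixteen
  have h0 : Complex.exp (Real.pi * Complex.I / 24) ≠ 0 := Complex.exp_ne_zero _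
  rw [upperGenerator_eq hq h0] at hA
  rw [lowerGenerator_eq hq h0] at hB
  have hAB : A * B⁻¹ = generatorQuotient (Complex.exp (Real.pi * Complex.I / 24)) := by
    rw [hA, hB, Matrix.inv_eq_left_inv (lowerGeneratorInv_mul hq),
      upperGenerator_mul_lowerGeneratorInv hq]
  have hdet : (A * B⁻¹).det = 1 := hAB ▸ det_generatorQuotient hq
  have hscalar : ∀ j : ℕ, 0 < j → ∀ c : ℂ,
      (A * B⁻¹) ^ j ≠ c • (1 : Matrix (Fin 4) (Fin 4) ℂ) := fun j hj c =>
    pow_ne_smul_one_of_lt_norm_trace_sq four_ne_zero hdet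
      (by rw [hAB]; exact_mod_cast four_lt_norm_trace_generatorQuotient_sq) hj c
  have hone : ∀ j : ℕ, 0 < j → (A * B⁻¹) ^ j ≠ 1 := fun j hj h =>
    hscalar j hj 1 (by rw [h, one_smul])
  refine ⟨hscalar, hone, Submonoid.infinite_of_mem_of_pow_ne_one _
    (Submonoid.mul_mem _ (Submonoid.subset_closure ?_) (Submonoid.subset_closure ?_))
    ((Matrix.isUnit_iff_isUnit_det _).mpr (hdet ▸ isUnit_one)) hone⟩ <;> simp
end

section
/- Let q = e^{iπ/20} and let A, B ∈ GL_4(ℂ) be the explicit matrices given below. Then for every positive integer j, the matrix (AB^{−1})^j is not a scalar multiple of the identity matrix; in particular AB^{−1} has infinite order and the subgroup of GL_4(ℂ) generated by A and B is infinite. -/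
/-- A complex matrix of finite order has trace of norm at most its size. -/
theorem Matrix.norm_trace_le_of_pow_eq_one {n : Type*} [Fintype n] [DecidableEq n]
    (M : Matrix n n ℂ) {k : ℕ} (hk : k ≠ 0) (h : M ^ k = 1) :
    ‖M.trace‖ ≤ Fintype.card n := by
  have hroot : ∀ μ ∈ M.charpoly.roots, ‖μ‖ ≤ 1 := by
    intro μ hμ
    have hev : Module.End.HasEigenvalue (Matrix.toLin' M) μ := by
      rw [Module.End.hasEigenvalue_iff_isRoot_charpoly, Matrix.charpoly_toLin']
      exact Polynomial.isRoot_of_mem_roots hμ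
    obtain ⟨v, hv⟩ := hev.exists_hasEigenvector
    have hpow := hv.pow_apply k
    rw [← Matrix.toLin'_pow, h, Matrix.toLin'_one, LinearMap.id_apply] at hpow
    have hμk : μ ^ k = 1 := by
      have h0 : (μ ^ k - 1) • v = 0 := by rw [sub_smul, one_smul, ← hpow, sub_self]
      exact sub_eq_zero.mp ((smul_eq_zero.mp h0).resolve_right hv.2)
    exact (Complex.norm_eq_one_of_pow_eq_one hμk hk).le
  rw [Matrix.trace_eq_sum_roots_charpoly]
  calc ‖M.charpoly.roots.sum‖ ≤ (M.charpoly.roots.map fun μ => ‖μ‖).sum :=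
        norm_multiset_sum_le _
    _ ≤ (M.charpoly.roots.map fun μ => ‖μ‖).card • (1 : ℝ) := by
        refine Multiset.sum_le_card_nsmul _ _ fun x hx => ?_
        obtain ⟨μ, hμ, rfl⟩ := Multiset.mem_map.mp hx
        exact hroot μ hμ
    _ ≤ Fintype.card n := by
        rw [Multiset.card_map, nsmul_eq_mul, mul_one, ← M.charpoly_natDegree_eq_dim]
        exact_mod_cast M.charpoly.card_roots'

/-- A determinant-one matrix with a scalar power has finite order. -/
theorem Matrix.exists_pow_eq_one_of_pow_eq_smul_one {n R : Type*} [Fintype n] [DecidableEq n]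
    [CommRing R] (M : Matrix n n R) (hdet : M.det = 1) {j : ℕ} {c : R}
    (h : M ^ j = c • (1 : Matrix n n R)) :
    M ^ (j * Fintype.card n) = 1 := by
  have hc : c ^ Fintype.card n = 1 := by
    have := congrArg Matrix.det h
    rwa [Matrix.det_pow, hdet, one_pow, Matrix.det_smul, Matrix.det_one, mul_one, eq_comm] at this
  rw [pow_mul, h, smul_pow, one_pow, hc, one_smul]

/-- The trace of `A * B⁻¹`, written as a polynomial in `q`, has norm larger than `4`. -/
theorem four_lt_norm_trace_polynomial :
    4 < ‖1 - 2 * (Complex.exp (Real.pi * Complex.I / 20) ^ 2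
        - Complex.exp (Real.pi * Complex.I / 20) ^ 18)
      - Complex.exp (Real.pi * Complex.I / 20) ^ 6 + Complex.exp (Real.pi * Complex.I / 20) ^ 14
      + Complex.exp (Real.pi * Complex.I / 20) ^ 4
      + Complex.exp (Real.pi * Complex.I / 20) ^ 16‖ := by
  have h20 : Complex.exp (Real.pi * Complex.I / 20) ^ 20 = -1 := by
    rw [← Complex.exp_nat_mul, ← Complex.exp_pi_mul_I]
    congr 1
    push_cast
    ring
  set q := Complex.exp (Real.pi * Complex.I / 20) with hq
  set c := Real.cos (Real.pi / 10) with hc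
  set s := Real.sin (Real.pi / 10) with hs
  have hz : q ^ 2 = c + s * Complex.I := by
    rw [hq, ← Complex.exp_nat_mul, hc, hs, Complex.ofReal_cos, Complex.ofReal_sin,
      ← Complex.exp_mul_I]
    congr 1
    push_cast
    ring
  have hcs : s ^ 2 + c ^ 2 = 1 := Real.sin_sq_add_cos_sq _
  have hcsC : (s : ℂ) ^ 2 + (c : ℂ) ^ 2 = 1 := by exact_mod_cast hcs
  have hconj : q ^ 18 = -(c - s * Complex.I) := by
    have hne : q ^ 2 ≠ 0 := by rw [hq]; exact pow_ne_zero _ (Complex.exp_ne_zero _)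
    apply mul_left_cancel₀ hne
    linear_combination h20 + (c - s * Complex.I) * hz + hcsC - s ^ 2 * Complex.I_sq
  have hc2 : c ^ 2 = (5 + √5) / 8 := by
    have h1 := Real.cos_sq (Real.pi / 10)
    rw [show 2 * (Real.pi / 10) = Real.pi / 5 by ring, Real.cos_pi_div_five] at h1
    rw [hc, h1]
    ring
  have hval : 1 - 2 * (q ^ 2 - q ^ 18) - q ^ 6 + q ^ 14 + q ^ 4 + q ^ 16
      = ((1 + 2 * c - 8 * c ^ 3 : ℝ) : ℂ) + ((4 * c * s : ℝ) : ℂ) * Complex.I := by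
    have h6 : q ^ 6 = (q ^ 2) ^ 3 := by ring
    have h4 : q ^ 4 = (q ^ 2) ^ 2 := by ring
    have h14 : q ^ 14 = (q ^ 18) ^ 3 := by linear_combination (-q ^ 14) * (q ^ 20 - 1) * h20
    have h16 : q ^ 16 = -(q ^ 18) ^ 2 := by linear_combination q ^ 16 * h20
    rw [h14, h16, h6, h4, hz, hconj]
    push_cast
    linear_combination (-6 * c * s ^ 2) * Complex.I_sq + (6 * c) * hcsC
  have hlt : (16 : ℝ) < ‖1 - 2 * (q ^ 2 - q ^ 18) - q ^ 6 + q ^ 14 + q ^ 4 + q ^ 16‖ ^ 2 := by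
    rw [hval, ← Complex.normSq_eq_norm_sq, Complex.normSq_add_mul_I]
    have h5 : √5 ^ 2 = 5 := Real.sq_sqrt (by norm_num)
    have h5l : (2.236 : ℝ) < √5 := Real.lt_sqrt_of_sq_lt (by norm_num)
    have h5u : √5 < 2.237 := by
      rw [Real.sqrt_lt' (by norm_num)]
      norm_num
    have hc0 : 0 < c :=
      Real.cos_pos_of_mem_Ioo ⟨by linarith [Real.pi_pos], by linarith [Real.pi_pos]⟩
    have hcl : (0.95 : ℝ) < c := by nlinarith
    have hre : (3.97 : ℝ) < 8 * c ^ 3 - 2 * c - 1 := by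
      have h3 : 8 * c ^ 3 - 2 * c = c * (3 + √5) := by linear_combination 8 * c * hc2
      nlinarith
    have him : (4 * c * s) ^ 2 = (10 - 2 * √5) / 4 := by
      have hs2 : s ^ 2 = 1 - (5 + √5) / 8 := by linarith
      rw [mul_pow, mul_pow, hc2, hs2]
      linear_combination (-1 / 4) * h5
    rw [him]
    nlinarith
  exact lt_of_pow_lt_pow_left₀ 2 (norm_nonneg _) (by linarith)


/-- For `q = e^{iπ/20}` and the explicit Tuba–Wenzl matrices `A`, `B`, every
positive power of `AB⁻¹` is non-scalar; in particular `AB⁻¹` has infinite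
order and the group generated by `A` and `B` is infinite. -/
theorem stmt_13 (q : ℂ) (hq : q = Complex.exp (Real.pi * Complex.I / 20))
    (A B : Matrix (Fin 4) (Fin 4) ℂ)
    (hA : A = !![q ^ (-12 : ℤ), (q ^ 8 + q ^ 4 + 1) / q ^ 6,
          -((q ^ 8 + q ^ 4 + 1) / q ^ 14), -1;
        0, q ^ 2, -((q ^ 4 - 1) / q ^ 10), -1;
        0, 0, -q ^ (-6 : ℤ), -1;
        0, 0, 0, -1])
    (hB : B = !![-1, 0, 0, 0;
        q ^ (-6 : ℤ), -q ^ (-6 : ℤ), 0, 0;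
        q ^ 6, -((q ^ 4 + 1) * q ^ 2), q ^ 2, 0;
        -1, (q ^ 8 + q ^ 4 + 1) / q ^ 8, -((q ^ 8 + q ^ 4 + 1) / q ^ 12),
          q ^ (-12 : ℤ)]) :
    (∀ j : ℕ, 0 < j → ∀ c : ℂ,
        (A * B⁻¹) ^ j ≠ c • (1 : Matrix (Fin 4) (Fin 4) ℂ)) ∧
    (∀ j : ℕ, 0 < j → (A * B⁻¹) ^ j ≠ 1) ∧
    Set.Infinite
      ((Submonoid.closure ({A, B, A⁻¹, B⁻¹} : Set (Matrix (Fin 4) (Fin 4) ℂ))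
        : Submonoid (Matrix (Fin 4) (Fin 4) ℂ)) : Set (Matrix (Fin 4) (Fin 4) ℂ)) := by
  have hqne : q ≠ 0 := hq ▸ Complex.exp_ne_zero _
  have h20 : q ^ 20 = -1 := by
    rw [hq, ← Complex.exp_nat_mul, ← Complex.exp_pi_mul_I]
    congr 1
    push_cast
    ring
  have hdetA : A.det = q ^ (-16 : ℤ) := by
    rw [hA, Matrix.det_of_isUpperTriangular]
    · simp [Fin.prod_univ_four]
      field_simp
    · intro i j hij
      fin_cases i <;> fin_cases j <;> first | rfl | exact absurd hij (by decide)
  have hdetB : B.det = q ^ (-16 : ℤ) := by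
    rw [hB, Matrix.det_of_isLowerTriangular]
    · simp [Fin.prod_univ_four]
      field_simp
    · intro i j hij
      fin_cases i <;> fin_cases j <;> first | rfl | exact absurd hij (by decide)
  have hdetne : q ^ (-16 : ℤ) ≠ 0 := zpow_ne_zero _ hqne
  have hBinv : B⁻¹ = !![-1, 0, 0, 0;
      -1, -q ^ 6, 0, 0;
      -1, -q ^ 10 - q ^ 6, (q ^ 2)⁻¹, 0;
      -1, -q ^ 14 - q ^ 10 - q ^ 6, q ^ 6 + q ^ 2 + (q ^ 2)⁻¹, q ^ 12] := by
    apply Matrix.inv_eq_right_inv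
    rw [hB]
    ext i j
    fin_cases i <;> fin_cases j <;>
      simp [Matrix.mul_apply, Fin.sum_univ_four, zpow_neg] <;> field_simp <;> ring
  have htr : (A * B⁻¹).trace =
      1 - 2 * (q ^ 2 - q ^ 18) - q ^ 6 + q ^ 14 + q ^ 4 + q ^ 16 := by
    rw [hBinv, hA]
    simp [Matrix.trace, Fin.sum_univ_four, zpow_neg]
    field_simp
    grind
  have hdet : (A * B⁻¹).det = 1 := by
    rw [Matrix.det_mul, Matrix.det_nonsing_inv, hdetA, hdetB,
      Ring.mul_inverse_cancel _ hdetne.isUnit]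
  have hone : ∀ j : ℕ, 0 < j → (A * B⁻¹) ^ j ≠ 1 := by
    intro j hj h
    have hle := Matrix.norm_trace_le_of_pow_eq_one _ hj.ne' h
    have hlt := four_lt_norm_trace_polynomial
    rw [← hq, ← htr] at hlt
    norm_num at hle
    linarith
  refine ⟨fun j hj c h => ?_, hone, ?_⟩
  · exact hone _ (by simpa using hj) (Matrix.exists_pow_eq_one_of_pow_eq_smul_one _ hdet h)
  · have hunit : IsUnit (A * B⁻¹) := by
      rw [Matrix.isUnit_iff_isUnit_det, hdet]
      exact isUnit_one
    have hinj : Function.Injective fun j : ℕ => (A * B⁻¹) ^ j := by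
      have key : ∀ a b : ℕ, a < b → (A * B⁻¹) ^ a ≠ (A * B⁻¹) ^ b := by
        intro a b hab h
        refine hone (b - a) (Nat.sub_pos_of_lt hab) ((hunit.pow a).mul_left_cancel ?_)
        rw [← pow_add, Nat.add_sub_cancel' hab.le, mul_one, h]
      intro a b h
      rcases lt_trichotomy a b with hab | hab | hab
      · exact absurd h (key a b hab)
      · exact hab
      · exact absurd h.symm (key b a hab)
    refine (Set.infinite_range_of_injective hinj).mono ?_
    rintro _ ⟨j, rfl⟩
    exact pow_mem (mul_mem (Submonoid.subset_closure (by simp))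
      (Submonoid.subset_closure (by simp))) j
end

section
/- Let ℓ ≥ 15 be an odd integer and q = e^{iπ/ℓ}. Then the five complex numbers q^{−24}, q^{−12}, q^2, −1, −q^{−6} are pairwise distinct, and the least positive integer t such that (q^{−24})^t = (q^{−12})^t = (q^2)^t = (−1)^t = (−q^{−6})^t equals 2ℓ. -/
/-- Powers of a primitive root of unity agree exactly when the exponents agree modulo its order. -/
theorem IsPrimitiveRoot.zpow_eq_zpow_iff_dvd {K : Type*} [Field K] {ζ : K} {n : ℕ}
    (h : IsPrimitiveRoot ζ n) (hζ : ζ ≠ 0) (a b : ℤ) :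
    ζ ^ a = ζ ^ b ↔ (n : ℤ) ∣ a - b := by
  rw [← h.zpow_eq_one_iff_dvd, zpow_sub₀ hζ, div_eq_one_iff_eq (zpow_ne_zero b hζ)]

/-- For odd `ℓ ≥ 15` and `q = e^{iπ/ℓ}`, the five numbers
`q^{-24}, q^{-12}, q^2, -1, -q^{-6}` are pairwise distinct, and the least
positive integer `t` with `(q^{-24})^t = (q^{-12})^t = (q^2)^t = (-1)^t = (-q^{-6})^t`
equals `2ℓ`. -/
theorem stmt_16 (ℓ : ℕ) (hℓ : 15 ≤ ℓ) (hodd : Odd ℓ)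
    (q : ℂ) (hq : q = Complex.exp (Real.pi * Complex.I / (ℓ : ℂ))) :
    ([q ^ (-24 : ℤ), q ^ (-12 : ℤ), q ^ (2 : ℤ), -1, -q ^ (-6 : ℤ)] : List ℂ).Pairwise
      (· ≠ ·) ∧
    IsLeast {t : ℕ | 0 < t ∧ (q ^ (-24 : ℤ)) ^ t = (q ^ (-12 : ℤ)) ^ t ∧
        (q ^ (-12 : ℤ)) ^ t = (q ^ (2 : ℤ)) ^ t ∧
        (q ^ (2 : ℤ)) ^ t = (-1 : ℂ) ^ t ∧
        (-1 : ℂ) ^ t = (-q ^ (-6 : ℤ)) ^ t} (2 * ℓ) := by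
  have hℓ0 : (ℓ : ℂ) ≠ 0 := by exact_mod_cast (by omega : ℓ ≠ 0)
  have hprim : IsPrimitiveRoot q (2 * ℓ) := by
    have h := Complex.isPrimitiveRoot_exp (2 * ℓ) (by omega)
    have he : (2 * Real.pi * Complex.I / ((2 * ℓ : ℕ) : ℂ)) = Real.pi * Complex.I / (ℓ : ℂ) := by
      push_cast
      field_simp
    rwa [he, ← hq] at h
  have hq0 : q ≠ 0 := hprim.ne_zero (by omega)
  have hneg : (-1 : ℂ) = q ^ (ℓ : ℤ) := by
    rw [zpow_natCast, hq, ← Complex.exp_nat_mul, mul_div_cancel₀ _ hℓ0, Complex.exp_pi_mul_I]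
  have hneg6 : -q ^ (-6 : ℤ) = q ^ ((ℓ : ℤ) - 6) := by
    rw [← neg_one_mul, hneg, ← zpow_add₀ hq0, sub_eq_add_neg]
  have key := hprim.zpow_eq_zpow_iff_dvd hq0
  rw [hneg6, hneg]
  obtain ⟨m, hm⟩ := hodd
  refine ⟨?_, ?_, ?_⟩
  · simp only [List.pairwise_cons, List.mem_cons, List.not_mem_nil, or_false, forall_eq_or_imp,
      forall_eq, ne_eq, key, List.Pairwise.nil, and_true, IsEmpty.forall_iff, implies_true]
    push_cast
    have small (k : ℤ) (h0 : k ≠ 0) (h1 : |k| < 30) : ¬ (2 * (ℓ : ℤ)) ∣ k := fun h =>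
      h0 (Int.eq_zero_of_abs_lt_dvd h (by omega))
    have odd (k : ℤ) (h : k % 2 = 1) : ¬ (2 * (ℓ : ℤ)) ∣ k := fun hd => by
      have := dvd_of_mul_right_dvd hd
      omega
    refine ⟨⟨?_, ?_, ?_, ?_⟩, ⟨?_, ?_, ?_⟩, ⟨?_, ?_⟩, ?_⟩ <;>
      first
      | exact odd _ (by omega)
      | exact small _ (by omega) (by rw [abs_lt]; omega)
  · have one (a : ℤ) : (q ^ a) ^ (2 * ℓ) = 1 := by
      rw [← zpow_natCast, zpow_comm, zpow_natCast, hprim.pow_eq_one, one_zpow]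
    simp only [Set.mem_ofPred_eq, one, and_true]
    omega
  · rintro t ⟨ht, h1, h2, h3, -⟩
    simp only [← zpow_natCast, ← zpow_mul, key] at h1 h2 h3
    push_cast at h1 h2 h3
    have h2t : 2 * (ℓ : ℤ) ∣ 2 * t := by
      have h := dvd_sub h1 h2
      ring_nf at h ⊢
      exact h
    have hℓt : 2 * (ℓ : ℤ) ∣ ℓ * t := by
      have h := dvd_sub h2t h3
      rwa [sub_sub_cancel] at h
    have hℓ_dvd : (ℓ : ℤ) ∣ t := (mul_dvd_mul_iff_left two_ne_zero).mp h2t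
    have htwo_dvd : (2 : ℤ) ∣ t := by
      rw [mul_comm] at hℓt
      exact (mul_dvd_mul_iff_left (by omega)).mp hℓt
    have hcop : IsCoprime (2 : ℤ) ℓ := ⟨-m, 1, by rw [hm]; push_cast; ring⟩
    have hdvd := hcop.mul_dvd htwo_dvd hℓ_dvd
    exact Nat.le_of_dvd ht (by exact_mod_cast hdvd)
end

section
/- Let (N, ℓ_0) be one of (6, 14), (7, 21), (8, 34), let ℓ ≥ ℓ_0 be an integer, and let q = e^{iπ/ℓ}. Then the three complex numbers q, −q^{−1}, q^{3−2N} are pairwise distinct, and the least positive integer t such that q^t = (−q^{−1})^t = (q^{3−2N})^t is at least 8. -/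
theorem IsPrimitiveRoot.zpow_eq_zpow_iff_dvd_sub {K : Type*} [Field K] {q : K} {n : ℕ}
    (h : IsPrimitiveRoot q n) (hn : n ≠ 0) (a b : ℤ) :
    q ^ a = q ^ b ↔ (n : ℤ) ∣ a - b := by
  have hq : q ≠ 0 := h.ne_zero hn
  rw [← h.zpow_eq_one_iff_dvd, zpow_sub₀ hq, div_eq_one_iff_eq (zpow_ne_zero _ hq)]

theorem Complex.isPrimitiveRoot_exp_pi_div {l : ℕ} (hl : l ≠ 0) :
    IsPrimitiveRoot (Complex.exp (Real.pi * Complex.I / (l : ℂ))) (2 * l) := by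
  convert Complex.isPrimitiveRoot_exp (2 * l) (by omega) using 2
  have : (l : ℂ) ≠ 0 := by exact_mod_cast hl
  push_cast
  field_simp

theorem Complex.neg_inv_exp_pi_div {l : ℕ} (hl : l ≠ 0) :
    -(Complex.exp (Real.pi * Complex.I / (l : ℂ)))⁻¹ =
      Complex.exp (Real.pi * Complex.I / (l : ℂ)) ^ ((l : ℤ) - 1) := by
  have hl' : (l : ℂ) ≠ 0 := by exact_mod_cast hl
  rw [zpow_sub_one₀ (Complex.exp_ne_zero _), zpow_natCast, ← Complex.exp_nat_mul,
    mul_div_cancel₀ _ hl', Complex.exp_pi_mul_I, neg_one_mul]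

/-- For `(N, ℓ₀) ∈ {(6,14), (7,21), (8,34)}`, `ℓ ≥ ℓ₀`, and `q = e^{iπ/ℓ}`, the
three numbers `q, -q⁻¹, q^{3-2N}` are pairwise distinct, and the least positive
`t` with `q^t = (-q⁻¹)^t = (q^{3-2N})^t` is at least `8`. -/
theorem stmt_17 (N ℓ₀ ℓ : ℕ)
    (hN : (N = 6 ∧ ℓ₀ = 14) ∨ (N = 7 ∧ ℓ₀ = 21) ∨ (N = 8 ∧ ℓ₀ = 34))
    (hℓ : ℓ₀ ≤ ℓ)
    (q : ℂ) (hq : q = Complex.exp (Real.pi * Complex.I / (ℓ : ℂ))) :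
    ([q, -q⁻¹, q ^ ((3 : ℤ) - 2 * N)] : List ℂ).Pairwise (· ≠ ·) ∧
    ∀ t : ℕ, 0 < t → q ^ t = (-q⁻¹) ^ t → (-q⁻¹) ^ t = (q ^ ((3 : ℤ) - 2 * N)) ^ t →
      8 ≤ t := by
  have hl : ℓ ≠ 0 := by omega
  have hneg : -q⁻¹ = q ^ ((ℓ : ℤ) - 1) := hq ▸ Complex.neg_inv_exp_pi_div hl
  have hprim : IsPrimitiveRoot q (2 * ℓ) := hq ▸ Complex.isPrimitiveRoot_exp_pi_div hl
  have key := hprim.zpow_eq_zpow_iff_dvd_sub (by omega)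
  push_cast at key
  rw [hneg]
  refine ⟨?_, fun t ht h₁ h₂ => ?_⟩
  · have not_dvd : ∀ x : ℤ, 0 < x → x < 2 * ℓ → ¬ (2 * (ℓ : ℤ)) ∣ x :=
      fun x h0 hx hd => absurd (Int.le_of_dvd h0 hd) (by omega)
    have h12 : q ≠ q ^ ((ℓ : ℤ) - 1) := fun h =>
      not_dvd _ (by omega) (by omega) ((key ((ℓ : ℤ) - 1) 1).1 (by rw [zpow_one]; exact h.symm))
    have h13 : q ≠ q ^ ((3 : ℤ) - 2 * N) := fun h =>
      not_dvd _ (by omega) (by omega) ((key 1 (3 - 2 * N)).1 (by rw [zpow_one]; exact h))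
    have h23 : q ^ ((ℓ : ℤ) - 1) ≠ q ^ ((3 : ℤ) - 2 * N) := fun h =>
      not_dvd _ (by omega) (by omega) ((key _ _).1 h)
    simp [h12, h13, h23]
  · by_contra! hlt
    have h₃ := h₁.trans h₂
    simp only [← zpow_natCast, ← zpow_mul] at h₁ h₃
    obtain ⟨c, hc⟩ := (key _ _).1 h₁
    obtain ⟨d, hd⟩ := (key _ _).1 h₃
    have hdvd : (ℓ : ℤ) ∣ 2 * t := ⟨2 * c + t, by linear_combination hc⟩
    have hle : (ℓ : ℤ) ≤ 2 * t := Int.le_of_dvd (by omega) hdvd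
    obtain rfl : t = 7 := by omega
    obtain rfl : ℓ = 14 := by omega
    obtain rfl : N = 6 := by omega
    norm_num at hd
    omega
end
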